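/- Let h: [0,∞) → [0,∞) be of class C² with h(0) = h'(0) = 0 and suppose there are constants c₁, c₂ > 0 and an exponent μ with 1 < μ < 2 such that c₁(1+t)^{−μ} ≤ min{h''(t), h'(t)/t} and max{h''(t), h'(t)/t} ≤ c₂/(1+t) for all t ≥ 0. Suppose u ∈ C¹(ℝ³, ℝ³) is divergence-free and a weak solution of the Stokes-type system −div[∇H(ε(u))] + ∇π = 0, i.e. ∫_{ℝ³} (h'(|ε(u)|)/|ε(u)|) ε(u) : ε(φ) dx = 0 for every divergence-free φ ∈ C_c^∞(ℝ³, ℝ³). If there is α ∈ [0, 1/2) such that |x|^{−α}|u(x)| is bounded on ℝ³ \ {0}, then u is a constant vector. -/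

import Mathlib

noncomputable section

open MeasureTheory Real Filter

/-- Partial derivative ∂ₖu(x) ∈ ℝⁿ of a vector field u : ℝⁿ → ℝⁿ. -/
def pd {n : ℕ} (u : EuclideanSpace ℝ (Fin n) → EuclideanSpace ℝ (Fin n))
    (k : Fin n) (x : EuclideanSpace ℝ (Fin n)) : EuclideanSpace ℝ (Fin n) :=
  fderiv ℝ u x (EuclideanSpace.single k 1)

/-- Divergence of u at x. -/
def divg {n : ℕ} (u : EuclideanSpace ℝ (Fin n) → EuclideanSpace ℝ (Fin n))
    (x : EuclideanSpace ℝ (Fin n)) : ℝ :=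
  ∑ k, pd u k x k

/-- Symmetric gradient ε(u)(x) = (1/2)(∇u + (∇u)ᵀ), entry (i,j) = (∂ⱼuⁱ + ∂ᵢuʲ)/2. -/
def symGrad {n : ℕ} (u : EuclideanSpace ℝ (Fin n) → EuclideanSpace ℝ (Fin n))
    (x : EuclideanSpace ℝ (Fin n)) : Matrix (Fin n) (Fin n) ℝ :=
  fun i j => (pd u j x i + pd u i x j) / 2

/-- Full gradient ∇u(x), entry (i,j) = ∂ⱼuⁱ. -/
def gradM {n : ℕ} (u : EuclideanSpace ℝ (Fin n) → EuclideanSpace ℝ (Fin n))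
    (x : EuclideanSpace ℝ (Fin n)) : Matrix (Fin n) (Fin n) ℝ :=
  fun i j => pd u j x i

/-- Frobenius inner product A : B. -/
def frob {n : ℕ} (A B : Matrix (Fin n) (Fin n) ℝ) : ℝ := ∑ i, ∑ j, A i j * B i j

/-- Frobenius norm |A|. -/
def fnorm {n : ℕ} (A : Matrix (Fin n) (Fin n) ℝ) : ℝ := Real.sqrt (frob A A)

/-- DH(ε) = (h'(|ε|)/|ε|) ε, interpreted as 0 at ε = 0. -/
def DH {n : ℕ} (h : ℝ → ℝ) (A : Matrix (Fin n) (Fin n) ℝ) : Matrix (Fin n) (Fin n) ℝ :=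
  if fnorm A = 0 then 0 else (deriv h (fnorm A) / fnorm A) • A

/-- u is a weak solution of -div DH(ε(u)) + (u·∇)u + ∇π = 0, div u = 0:
for all smooth compactly supported divergence-free φ,
∫ DH(ε(u)) : ε(φ) dx + ∫ uᵏ ∂ₖuⁱ φⁱ dx = 0. -/
def IsWeakSolution {n : ℕ} (h : ℝ → ℝ)
    (u : EuclideanSpace ℝ (Fin n) → EuclideanSpace ℝ (Fin n)) : Prop :=
  ∀ φ : EuclideanSpace ℝ (Fin n) → EuclideanSpace ℝ (Fin n),
    ContDiff ℝ (⊤ : ℕ∞) φ → HasCompactSupport φ → (∀ x, divg φ x = 0) →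
    (∫ x, frob (DH h (symGrad u x)) (symGrad φ x)) +
      (∫ x, ∑ k, ∑ i, u x k * pd u k x i * φ x i) = 0

/-- u is a weak solution of the Stokes-type system -div DH(ε(u)) + ∇π = 0, div u = 0:
for all smooth compactly supported divergence-free φ, ∫ DH(ε(u)) : ε(φ) dx = 0. -/
def IsStokesWeakSolution {n : ℕ} (h : ℝ → ℝ)
    (u : EuclideanSpace ℝ (Fin n) → EuclideanSpace ℝ (Fin n)) : Prop :=
  ∀ φ : EuclideanSpace ℝ (Fin n) → EuclideanSpace ℝ (Fin n),
    ContDiff ℝ (⊤ : ℕ∞) φ → HasCompactSupport φ → (∀ x, divg φ x = 0) →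
    (∫ x, frob (DH h (symGrad u x)) (symGrad φ x)) = 0

/-- The open square Q_R(x₀) ⊂ ℝ². -/
def sqr (R : ℝ) (x₀ : EuclideanSpace ℝ (Fin 2)) : Set (EuclideanSpace ℝ (Fin 2)) :=
  {x | |x 0 - x₀ 0| < R ∧ |x 1 - x₀ 1| < R}

/-- h'(t)/t, extended by h''(0) at t = 0. -/
def slopeH (h : ℝ → ℝ) (t : ℝ) : ℝ :=
  if t = 0 then deriv (deriv h) 0 else deriv h t / t

section
open MeasureTheory Real Filter

lemma frob_self_nonneg {n : ℕ} (A : Matrix (Fin n) (Fin n) ℝ) : 0 ≤ frob A A := by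
  unfold frob
  exact Finset.sum_nonneg fun i _ => Finset.sum_nonneg fun j _ => mul_self_nonneg _

lemma fnorm_nonneg {n : ℕ} (A : Matrix (Fin n) (Fin n) ℝ) : 0 ≤ fnorm A := Real.sqrt_nonneg _

lemma fnorm_sq {n : ℕ} (A : Matrix (Fin n) (Fin n) ℝ) : fnorm A ^ 2 = frob A A :=
  Real.sq_sqrt (frob_self_nonneg A)

lemma frob_le {n : ℕ} (A B : Matrix (Fin n) (Fin n) ℝ) : frob A B ≤ fnorm A * fnorm B := by
  have := Real.sum_mul_le_sqrt_mul_sqrt (Finset.univ : Finset (Fin n × Fin n))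
    (fun p => A p.1 p.2) (fun p => B p.1 p.2)
  simp only [Fintype.sum_prod_type] at this
  simpa only [fnorm, frob, ← pow_two] using this

lemma frob_smul_left {n : ℕ} (c : ℝ) (A B : Matrix (Fin n) (Fin n) ℝ) :
    frob (c • A) B = c * frob A B := by
  simp [frob, Finset.mul_sum, mul_assoc]

lemma frob_comm {n : ℕ} (A B : Matrix (Fin n) (Fin n) ℝ) : frob A B = frob B A := by
  simp [frob, mul_comm]

lemma frob_sub_left {n : ℕ} (A B C : Matrix (Fin n) (Fin n) ℝ) :
    frob (A - B) C = frob A C - frob B C := by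
  simp [frob, sub_mul, Finset.sum_sub_distrib]

lemma frob_sub_right {n : ℕ} (A B C : Matrix (Fin n) (Fin n) ℝ) :
    frob A (B - C) = frob A B - frob A C := by
  simp [frob, mul_sub, Finset.sum_sub_distrib]

lemma frob_smul_right {n : ℕ} (c : ℝ) (A B : Matrix (Fin n) (Fin n) ℝ) :
    frob A (c • B) = c * frob A B := by
  rw [frob_comm, frob_smul_left, frob_comm]

lemma fnorm_eq_zero {n : ℕ} {A : Matrix (Fin n) (Fin n) ℝ} (h : fnorm A = 0) : A = 0 := by
  have h2 : frob A A = 0 := by rw [← fnorm_sq, h]; simp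
  have h3 : ∀ i, ∑ j, A i j * A i j = 0 := fun i =>
    (Finset.sum_eq_zero_iff_of_nonneg (s := Finset.univ) (f := fun i => ∑ j, A i j * A i j)
      (fun i _ => Finset.sum_nonneg fun j _ => mul_self_nonneg _)).1 h2 i (Finset.mem_univ _)
  have h4 : ∀ i j, A i j * A i j = 0 := fun i j =>
    (Finset.sum_eq_zero_iff_of_nonneg (s := Finset.univ) (f := fun j => A i j * A i j)
      (fun j _ => mul_self_nonneg _)).1 (h3 i) j (Finset.mem_univ _)
  ext i j
  simpa using h4 i j

lemma DH_eq {n : ℕ} (h : ℝ → ℝ) (A : Matrix (Fin n) (Fin n) ℝ) :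
    DH h A = slopeH h (fnorm A) • A := by
  unfold DH slopeH
  split_ifs with h1
  · rw [fnorm_eq_zero h1]; simp
  · rfl

lemma slopeH_mul (h : ℝ → ℝ) (h0' : deriv h 0 = 0) (t : ℝ) : slopeH h t * t = deriv h t := by
  unfold slopeH
  split_ifs with h1
  · simp [h1, h0']
  · field_simp

/-- mean value for `h'` -/
lemma deriv_mvt {h : ℝ → ℝ} (hreg : ContDiff ℝ 2 h) {a b : ℝ} (hab : a < b) :
    ∃ ξ ∈ Set.Ioo a b, deriv h b - deriv h a = deriv (deriv h) ξ * (b - a) := by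
  have hd : Differentiable ℝ (deriv h) := by
    have : ContDiff ℝ 1 (deriv h) := ((contDiff_succ_iff_deriv (n := 1)).1 hreg).2.2
    exact this.differentiable (by norm_num)
  obtain ⟨ξ, hξ, h1⟩ := exists_deriv_eq_slope (deriv h) hab hd.continuous.continuousOn
    hd.differentiableOn
  refine ⟨ξ, hξ, ?_⟩
  rw [h1, div_mul_cancel₀]
  linarith

section
variable {h : ℝ → ℝ} {c₁ c₂ μ : ℝ}

lemma mono_real (hc₁ : 0 < c₁) (hμ₁ : 1 < μ)
    (hreg : ContDiff ℝ 2 h)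
    (hlow : ∀ t, 0 ≤ t → c₁ * (1 + t) ^ (-μ) ≤ min (deriv (deriv h) t) (slopeH h t))
    (hup : ∀ t, 0 ≤ t → max (deriv (deriv h) t) (slopeH h t) ≤ c₂ / (1 + t)) (hc₂ : 0 < c₂)
    {a b : ℝ} (ha : 0 ≤ a) (hb : 0 ≤ b) :
    c₁ * (1 + a + b) ^ (-μ) * (a - b) ^ 2 ≤ (deriv h a - deriv h b) * (a - b) ∧
    (deriv h a - deriv h b) ^ 2 ≤ c₂ * ((deriv h a - deriv h b) * (a - b)) := by
  wlog hab : b < a generalizing a b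
  · rcases eq_or_lt_of_le (not_lt.1 hab) with h1 | h1
    · simp [h1]
    · have := this hb ha h1
      constructor
      · have h2 := this.1
        rw [show 1 + b + a = 1 + a + b by ring] at h2
        nlinarith [h2]
      · nlinarith [this.2]
  obtain ⟨ξ, ⟨h1, h2⟩, h3⟩ := deriv_mvt hreg hab
  have hξ : 0 ≤ ξ := by linarith
  have l1 := (hlow ξ hξ).trans (min_le_left _ _)
  have u1 := (le_max_left _ _).trans (hup ξ hξ)
  have l2 : c₁ * (1 + a + b) ^ (-μ) ≤ c₁ * (1 + ξ) ^ (-μ) := by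
    refine mul_le_mul_of_nonneg_left ?_ hc₁.le
    apply Real.rpow_le_rpow_of_nonpos <;> linarith
  have u2 : c₂ / (1 + ξ) ≤ c₂ := div_le_self hc₂.le (by linarith)
  have l3 : 0 ≤ c₁ * (1 + ξ) ^ (-μ) := by positivity
  rw [h3]
  set D := deriv (deriv h) ξ
  have hD : 0 ≤ D := by linarith
  constructor
  · nlinarith [sq_nonneg (a - b)]
  · have : D * D ≤ c₂ * D := by nlinarith
    nlinarith [sq_nonneg (a - b)]

lemma slope_bounds
    (hlow : ∀ t, 0 ≤ t → c₁ * (1 + t) ^ (-μ) ≤ min (deriv (deriv h) t) (slopeH h t))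
    (hup : ∀ t, 0 ≤ t → max (deriv (deriv h) t) (slopeH h t) ≤ c₂ / (1 + t)) (hc₂ : 0 < c₂)
    {a : ℝ} (ha : 0 ≤ a) :
    c₁ * (1 + a) ^ (-μ) ≤ slopeH h a ∧ slopeH h a ≤ c₂ := by
  refine ⟨(hlow a ha).trans (min_le_right _ _), ?_⟩
  exact ((le_max_right _ _).trans (hup a ha)).trans (div_le_self hc₂.le (by linarith))

lemma DH_mono {n : ℕ} (hc₁ : 0 < c₁) (hc₂ : 0 < c₂) (hμ₁ : 1 < μ)
    (hreg : ContDiff ℝ 2 h) (h0' : deriv h 0 = 0)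
    (hlow : ∀ t, 0 ≤ t → c₁ * (1 + t) ^ (-μ) ≤ min (deriv (deriv h) t) (slopeH h t))
    (hup : ∀ t, 0 ≤ t → max (deriv (deriv h) t) (slopeH h t) ≤ c₂ / (1 + t))
    (A B : Matrix (Fin n) (Fin n) ℝ) :
    c₁ * (1 + fnorm A + fnorm B) ^ (-μ) * frob (A - B) (A - B)
        ≤ frob (DH h A - DH h B) (A - B) ∧
    frob (DH h A - DH h B) (DH h A - DH h B) ≤ c₂ * frob (DH h A - DH h B) (A - B) := by
  have ha := fnorm_nonneg A
  have hb := fnorm_nonneg B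
  have hs := frob_le A B
  obtain ⟨m1, m2⟩ := mono_real (h := h) hc₁ hμ₁ hreg hlow hup hc₂ ha hb
  obtain ⟨la, ua⟩ := slope_bounds (h := h) hlow hup hc₂ ha
  obtain ⟨lb, ub⟩ := slope_bounds (h := h) hlow hup hc₂ hb
  rw [← slopeH_mul h h0' (fnorm A), ← slopeH_mul h h0' (fnorm B)] at m1 m2
  rw [DH_eq, DH_eq]
  simp only [frob_sub_left, frob_sub_right, frob_smul_left, frob_smul_right, frob_comm B A]
  simp only [← fnorm_sq]
  have l2 : c₁ * (1 + fnorm A + fnorm B) ^ (-μ) ≤ slopeH h (fnorm A) := by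
    refine le_trans ?_ la
    refine mul_le_mul_of_nonneg_left ?_ hc₁.le
    apply Real.rpow_le_rpow_of_nonpos <;> linarith
  have l3 : c₁ * (1 + fnorm A + fnorm B) ^ (-μ) ≤ slopeH h (fnorm B) := by
    refine le_trans ?_ lb
    refine mul_le_mul_of_nonneg_left ?_ hc₁.le
    apply Real.rpow_le_rpow_of_nonpos <;> linarith
  have l4 : 0 ≤ c₁ * (1 + fnorm A + fnorm B) ^ (-μ) := by positivity
  set m := c₁ * (1 + fnorm A + fnorm B) ^ (-μ)
  set a := fnorm A
  set b := fnorm B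
  set p := slopeH h a
  set q := slopeH h b
  set s := frob A B
  have hd : 0 ≤ a * b - s := by linarith
  constructor
  · have : 0 ≤ (p + q - 2 * m) * (a * b - s) := mul_nonneg (by linarith) hd
    nlinarith
  · have h1 : 0 ≤ (c₂ * (p + q) - 2 * (p * q)) := by
      have : p * q ≤ c₂ * q := mul_le_mul_of_nonneg_right ua (by linarith)
      have : p * q ≤ c₂ * p := by nlinarith
      linarith
    have : 0 ≤ (c₂ * (p + q) - 2 * (p * q)) * (a * b - s) := mul_nonneg h1 hd
    nlinarith

end

end

section
open MeasureTheory Real Filter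

/-- three dimensional Euclidean space -/
abbrev E3 := EuclideanSpace ℝ (Fin 3)

/-- basis vectors -/
noncomputable def ee (j : Fin 3) : E3 := EuclideanSpace.single j 1

/-- partial derivative of a scalar function -/
noncomputable def dd (j : Fin 3) (f : E3 → ℝ) (x : E3) : ℝ := fderiv ℝ f x (ee j)

lemma norm_ee (j : Fin 3) : ‖ee j‖ = 1 := by simp [ee]

lemma hcs_of {F : Type*} [Zero F] {f : E3 → F} {r : ℝ} (h : ∀ x, r ≤ ‖x‖ → f x = 0) :
    HasCompactSupport f :=
  HasCompactSupport.intro (isCompact_closedBall (0 : E3) r) fun x hx => h x (by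
    simp at hx; exact hx.le)

lemma radius_of {F : Type*} [Zero F] {f : E3 → F} (h : HasCompactSupport f) :
    ∃ r, 0 < r ∧ ∀ x, r ≤ ‖x‖ → f x = 0 := by
  obtain ⟨r, hr⟩ := (h.isCompact.isBounded).subset_ball (0 : E3)
  refine ⟨max r 1, by positivity, fun x hx => ?_⟩
  by_contra h1
  have := hr (subset_tsupport f h1)
  simp at this
  linarith [le_max_left r 1]

lemma approx {F : Type*} [NormedAddCommGroup F] [NormedSpace ℝ F] [CompleteSpace F]
    {f : E3 → F} (hf : ContDiff ℝ 1 f) {r : ℝ} (hr : ∀ x, r ≤ ‖x‖ → f x = 0)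
    {τ : ℝ} (hτ : 0 < τ) :
    ∃ g : E3 → F, ContDiff ℝ (⊤ : ℕ∞) g ∧ (∀ x, r + 1 ≤ ‖x‖ → g x = 0) ∧
      (∀ x, ‖fderiv ℝ g x - fderiv ℝ f x‖ ≤ τ) ∧
      ∀ L : (E3 →L[ℝ] F) →L[ℝ] ℝ, (∀ x, L (fderiv ℝ f x) = 0) → ∀ x, L (fderiv ℝ g x) = 0 := by
  have hfc : HasCompactSupport f := hcs_of hr
  have hf'c : Continuous (fderiv ℝ f) := hf.continuous_fderiv (by norm_num)
  have huc : UniformContinuous (fderiv ℝ f) := by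
    apply Continuous.uniformContinuous_of_tendsto_cocompact (x := 0) hf'c
    exact (hfc.fderiv ℝ).is_zero_at_infty
  obtain ⟨δ, hδ, hδ2⟩ := Metric.uniformContinuous_iff.1 huc τ hτ
  have hm : 0 < min δ 1 := by positivity
  let ρ : ContDiffBump (0 : E3) := ⟨min δ 1 / 2, min δ 1, by positivity, by linarith⟩
  let g : E3 → F := convolution (ρ.normed volume) f (ContinuousLinearMap.lsmul ℝ ℝ) volume
  have hg' : ∀ x, HasFDerivAt g (convolution (ρ.normed volume) (fderiv ℝ f)
      (ContinuousLinearMap.lsmul ℝ ℝ) volume x) x := by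
    intro x
    have := HasCompactSupport.hasFDerivAt_convolution_right (𝕜 := ℝ) (μ := (volume : Measure E3))
      (ContinuousLinearMap.lsmul ℝ ℝ) hfc
      (ρ.contDiff_normed (n := 0) (μ := volume)).continuous.locallyIntegrable hf x
    exact this
  refine ⟨g, ?_, ?_, ?_, ?_⟩
  · exact HasCompactSupport.contDiff_convolution_left _ ρ.hasCompactSupport_normed
      ρ.contDiff_normed hf.continuous.locallyIntegrable
  · intro x hx
    change ∫ t, _ = _
    have : ∀ t, (ContinuousLinearMap.lsmul ℝ ℝ) (ρ.normed volume t) (f (x - t)) = 0 := by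
      intro t
      by_cases ht : ‖t‖ < 1
      · have : r ≤ ‖x - t‖ := by linarith [norm_sub_norm_le x t]
        rw [hr _ this]; simp
      · have : ρ.normed volume t = 0 := by
          by_contra h1
          have h2 : t ∈ Function.support (ρ.normed volume) := h1
          rw [ρ.support_normed_eq] at h2
          simp [ρ] at h2
          exact ht h2.2
        rw [this]; simp
    simp [this]
  · intro x
    rw [(hg' x).fderiv, ← dist_eq_norm]
    refine ContDiffBump.dist_normed_convolution_le hf'c.aestronglyMeasurable ?_
    intro y hy
    refine (hδ2 ?_).le
    refine lt_of_lt_of_le (Metric.mem_ball.1 hy) (min_le_left _ _)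
  · intro L hL x
    rw [(hg' x).fderiv]
    change L (∫ t, _) = 0
    rw [← ContinuousLinearMap.integral_comp_comm]
    · simp [hL]
    · exact HasCompactSupport.convolutionExists_right (ContinuousLinearMap.lsmul ℝ ℝ)
        (hfc.fderiv ℝ) 
        (ρ.contDiff_normed (n := 0) (μ := volume)).continuous.locallyIntegrable hf'c x

lemma int_cs {f : E3 → ℝ} (hf : Continuous f) {r : ℝ} (hr : ∀ x, r ≤ ‖x‖ → f x = 0) :
    Integrable f := hf.integrable_of_hasCompactSupport (hcs_of hr)

lemma dd_zero_of {f : E3 → ℝ} {r : ℝ} (hr : ∀ x, r ≤ ‖x‖ → f x = 0) (j : Fin 3) :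
    ∀ x, r < ‖x‖ → dd j f x = 0 := by
  intro x hx
  have : f =ᶠ[nhds x] fun _ => (0 : ℝ) := by
    filter_upwards [(isOpen_lt continuous_const continuous_norm).mem_nhds hx] with y hy
    exact hr y (le_of_lt hy)
  simp [dd, this.fderiv_eq]

/-- difference of two integrals over a ball, with error `τ`. -/
lemma int_diff {f g : E3 → ℝ} (hf : Integrable f) (hg : Integrable g) {r τ : ℝ}
    (hfr : ∀ x, r ≤ ‖x‖ → f x = 0) (hgr : ∀ x, r ≤ ‖x‖ → g x = 0)
    (h : ∀ x, ‖x‖ < r → |f x - g x| ≤ τ) :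
    |(∫ x, f x) - ∫ x, g x| ≤ τ * volume.real (Metric.ball (0 : E3) r) := by
  rw [← integral_sub hf hg]
  have : ∫ x, (f x - g x) = ∫ x in Metric.ball (0 : E3) r, (f x - g x) := by
    symm
    apply setIntegral_eq_integral_of_forall_compl_eq_zero
    intro x hx
    simp at hx
    rw [hfr x hx, hgr x hx]; simp
  rw [this]
  have h2 : ∀ x ∈ Metric.ball (0 : E3) r, ‖f x - g x‖ ≤ τ := by
    intro x hx
    rw [mem_ball_zero_iff] at hx
    exact h x hx
  have h3 : volume (Metric.ball (0 : E3) r) < ⊤ := measure_ball_lt_top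
  exact norm_setIntegral_le_of_norm_le_const h3 h2

lemma dd_cont {f : E3 → ℝ} (hf : ContDiff ℝ 1 f) (j : Fin 3) : Continuous (dd j f) :=
  (hf.continuous_fderiv (by norm_num)).clm_apply continuous_const

lemma dd_contDiff {f : E3 → ℝ} {n : ℕ∞} (hf : ContDiff ℝ (n + 1) f) (j : Fin 3) :
    ContDiff ℝ n (dd j f) :=
  (hf.fderiv_right le_rfl).clm_apply contDiff_const

lemma dd_swap {f : E3 → ℝ} (hf : ContDiff ℝ 2 f) (i j : Fin 3) (x : E3) :
    dd i (dd j f) x = dd j (dd i f) x := by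
  have hd : DifferentiableAt ℝ (fderiv ℝ f) x :=
    ((hf.fderiv_right (m := 1) (by norm_num)).differentiable (by norm_num)) x
  have h1 : ∀ k l, dd k (dd l f) x = fderiv ℝ (fderiv ℝ f) x (ee k) (ee l) := by
    intro k l
    unfold dd
    rw [fderiv_clm_apply hd (by fun_prop)]
    simp
  rw [h1, h1]
  have := (hf.contDiffAt (x := x)).isSymmSndFDerivAt (by simp)
  exact this (ee i) (ee j)

lemma dd_mul {f g : E3 → ℝ} (hf : Differentiable ℝ f) (hg : Differentiable ℝ g) (j : Fin 3) (x : E3) :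
    dd j (fun y => f y * g y) x = f x * dd j g x + dd j f x * g x := by
  unfold dd
  rw [show (fun y => f y * g y) = f * g from rfl, fderiv_mul (hf x) (hg x)]
  simp; ring

lemma ibp {f g : E3 → ℝ} (hf : ContDiff ℝ 1 f) (hg : ContDiff ℝ 1 g) {r : ℝ}
    (hr : ∀ x, r ≤ ‖x‖ → f x = 0) (j : Fin 3) :
    ∫ x, f x * dd j g x = - ∫ x, dd j f x * g x := by
  have hr' : ∀ x, r + 1 ≤ ‖x‖ → dd j f x = 0 := fun x hx => dd_zero_of hr j x (by linarith)
  apply integral_mul_fderiv_eq_neg_fderiv_mul_of_integrable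
  · exact int_cs (r := r + 1) ((dd_cont hf j).mul hg.continuous) fun x hx => by
      have := hr' x hx; unfold dd at this; simp [this]
  · exact int_cs (r := r) (hf.continuous.mul (dd_cont hg j)) fun x hx => by simp [hr x hx]
  · exact int_cs (r := r) (hf.continuous.mul hg.continuous) fun x hx => by simp [hr x hx]
  · intro x _; exact hf.differentiable (by norm_num) x
  · intro x _; exact hg.differentiable (by norm_num) x

lemma exchange_smooth {f g : E3 → ℝ} (hf : ContDiff ℝ 2 f) (hg : ContDiff ℝ 1 g) {r : ℝ}
    (hr : ∀ x, r ≤ ‖x‖ → f x = 0) (i j : Fin 3) :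
    ∫ x, dd i f x * dd j g x = ∫ x, dd j f x * dd i g x := by
  have hr' : ∀ k, ∀ x, r + 1 ≤ ‖x‖ → dd k f x = 0 :=
    fun k x hx => dd_zero_of hr k x (by linarith)
  have hfc : ∀ k, ContDiff ℝ 1 (dd k f) := fun k => dd_contDiff (n := 1) (by simpa [one_add_one_eq_two] using hf) k
  rw [ibp (hfc i) hg (hr' i) j, ibp (hfc j) hg (hr' j) i]
  simp only [dd_swap hf i j]

lemma exchange {f g : E3 → ℝ} (hf : ContDiff ℝ 1 f) (hg : ContDiff ℝ 1 g) {r : ℝ}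
    (hr : ∀ x, r ≤ ‖x‖ → f x = 0) (i j : Fin 3) :
    ∫ x, dd i f x * dd j g x = ∫ x, dd j f x * dd i g x := by
  obtain ⟨B, hB⟩ : ∃ B, ∀ k, ∀ x ∈ Metric.closedBall (0 : E3) (r + 2), |dd k g x| ≤ B := by
    have : ∀ k, ∃ B, ∀ x ∈ Metric.closedBall (0 : E3) (r + 2), |dd k g x| ≤ B := fun k =>
      (isCompact_closedBall (0 : E3) (r + 2)).exists_bound_of_continuousOn
        (dd_cont hg k).continuousOn
    choose B hB using this
    refine ⟨∑ k, |B k|, fun k x hx => ((hB k x hx).trans (le_abs_self _)).trans ?_⟩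
    exact Finset.single_le_sum (f := fun k => |B k|) (fun _ _ => abs_nonneg _) (Finset.mem_univ k)
  set V := volume.real (Metric.ball (0 : E3) (r + 2))
  have key : ∀ τ > 0, |(∫ x, dd i f x * dd j g x) - ∫ x, dd j f x * dd i g x| ≤
      τ * (|B| * V) + τ * (|B| * V) := by
    intro τ hτ
    obtain ⟨F, hF, hFr, hFd, -⟩ := approx hf hr hτ
    have hF1 : ContDiff ℝ 1 F := contDiff_infty.1 hF 1
    have hF2 : ContDiff ℝ 2 F := contDiff_infty.1 hF 2
    have h1 : ∀ k l, |(∫ x, dd k F x * dd l g x) - ∫ x, dd k f x * dd l g x| ≤ τ * |B| * V := by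
      intro k l
      have z1 : ∀ x, r + 2 ≤ ‖x‖ → dd k F x * dd l g x = 0 := fun x hx => by
        rw [dd_zero_of hFr k x (by linarith)]; simp
      have z2 : ∀ x, r + 2 ≤ ‖x‖ → dd k f x * dd l g x = 0 := fun x hx => by
        rw [dd_zero_of hr k x (by linarith)]; simp
      apply int_diff (int_cs ((dd_cont hF1 k).mul (dd_cont hg l)) z1)
        (int_cs ((dd_cont hf k).mul (dd_cont hg l)) z2) z1 z2
      intro x hx
      simp only [Pi.mul_apply]
      rw [← sub_mul, abs_mul]
      refine mul_le_mul ?_ ?_ (abs_nonneg _) hτ.le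
      · have := ContinuousLinearMap.le_opNorm (fderiv ℝ F x - fderiv ℝ f x) (ee k)
        rw [norm_ee, mul_one] at this
        exact this.trans (hFd x)
      · exact (hB l x (by simp; linarith)).trans (le_abs_self _)
    have h2 := exchange_smooth hF2 hg hFr i j
    have h3 := h1 i j
    have h4 := h1 j i
    rw [abs_le] at h3 h4 ⊢
    constructor <;> linarith [h3.1, h3.2, h4.1, h4.2, h2]
  have : |(∫ x, dd i f x * dd j g x) - ∫ x, dd j f x * dd i g x| ≤ 0 := by
    apply le_of_forall_pos_le_add
    intro η hη
    have hV : 0 ≤ |B| * V := by positivity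
    have := key (η / (2 * (|B| * V + 1))) (by positivity)
    refine this.trans ?_
    rw [← two_mul, zero_add]
    have : 2 * (η / (2 * (|B| * V + 1)) * (|B| * V)) = η * ((|B| * V) / (|B| * V + 1)) := by
      field_simp
    rw [this]
    have : (|B| * V) / (|B| * V + 1) ≤ 1 := by
      rw [div_le_one (by positivity)]; linarith
    nlinarith
  have := abs_nonpos_iff.1 this
  linarith

end

section
open MeasureTheory Real Filter

/-- Steklov average of `f` in direction `z` -/
noncomputable def avg (z : E3) (f : E3 → ℝ) (x : E3) : ℝ := ∫ s in (0 : ℝ)..1, f (x + s • z)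

lemma avg_hasFDerivAt {f : E3 → ℝ} (hf : ContDiff ℝ 1 f) (z x : E3) :
    HasFDerivAt (avg z f) (∫ s in (0 : ℝ)..1, fderiv ℝ f (x + s • z)) x := by
  have hf' : Continuous (fderiv ℝ f) := hf.continuous_fderiv (by norm_num)
  obtain ⟨B, hB⟩ := (isCompact_closedBall (0 : E3) (‖x‖ + 1 + ‖z‖)).exists_bound_of_continuousOn
    hf'.continuousOn
  have hcs : ∀ y : E3, Continuous fun s : ℝ => y + s • z := fun y => by fun_prop
  refine (intervalIntegral.hasFDerivAt_integral_of_dominated_of_fderiv_le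
    (μ := volume) (F := fun y s => f (y + s • z)) (F' := fun y s => fderiv ℝ f (y + s • z))
    (bound := fun _ => B) (Metric.ball_mem_nhds x one_pos) ?_ ?_ ?_ ?_ ?_ ?_)
  · exact Eventually.of_forall fun y => (hf.continuous.comp (hcs y)).aestronglyMeasurable
  · exact (hf.continuous.comp (hcs x)).intervalIntegrable _ _
  · exact (hf'.comp (hcs x)).aestronglyMeasurable
  · refine Eventually.of_forall fun s hs y hy => hB _ ?_
    rw [Set.uIoc_of_le zero_le_one] at hs
    rw [mem_closedBall_zero_iff]
    have h1 : ‖y‖ ≤ ‖x‖ + 1 := by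
      have := Metric.mem_ball.1 hy
      rw [dist_eq_norm] at this
      linarith [norm_sub_norm_le y x]
    have h2 : ‖s • z‖ ≤ ‖z‖ := by
      rw [norm_smul, Real.norm_eq_abs, abs_of_pos hs.1]
      nlinarith [norm_nonneg z, hs.2]
    linarith [norm_add_le y (s • z)]
  · exact intervalIntegrable_const
  · refine Eventually.of_forall fun s hs y hy => ?_
    have h1 : HasFDerivAt f (fderiv ℝ f (y + s • z)) (y + s • z) :=
      (hf.differentiable (by norm_num) _).hasFDerivAt
    have := h1.comp y ((hasFDerivAt_id y).add_const (s • z))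
    rw [ContinuousLinearMap.comp_id] at this
    exact this

lemma avg_cont {f : E3 → ℝ} (hf : Continuous f) (z : E3) : Continuous (avg z f) := by
  unfold avg
  apply intervalIntegral.continuous_parametric_intervalIntegral_of_continuous'
  fun_prop

lemma avg_contDiff {f : E3 → ℝ} (hf : ContDiff ℝ 1 f) (z : E3) : ContDiff ℝ 1 (avg z f) := by
  have hf' : Continuous (fderiv ℝ f) := hf.continuous_fderiv (by norm_num)
  rw [contDiff_one_iff_fderiv]
  refine ⟨fun x => (avg_hasFDerivAt hf z x).differentiableAt, ?_⟩
  have : fderiv ℝ (avg z f) = fun x => ∫ s in (0 : ℝ)..1, fderiv ℝ f (x + s • z) :=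
    funext fun x => (avg_hasFDerivAt hf z x).fderiv
  rw [this]
  apply intervalIntegral.continuous_parametric_intervalIntegral_of_continuous'
  fun_prop

lemma avg_dd {f : E3 → ℝ} (hf : ContDiff ℝ 1 f) (z : E3) (j : Fin 3) (x : E3) :
    dd j (avg z f) x = avg z (dd j f) x := by
  have hf' : Continuous (fderiv ℝ f) := hf.continuous_fderiv (by norm_num)
  unfold dd
  rw [(avg_hasFDerivAt hf z x).fderiv, ContinuousLinearMap.intervalIntegral_apply]
  · rfl
  · apply Continuous.intervalIntegrable
    fun_prop

lemma avg_diff {f : E3 → ℝ} (hf : ContDiff ℝ 1 f) (k : Fin 3) (t : ℝ) (x : E3) :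
    t * avg (t • ee k) (dd k f) x = f (x + t • ee k) - f x := by
  have hf' : Continuous (fderiv ℝ f) := hf.continuous_fderiv (by norm_num)
  have h1 : ∀ s ∈ Set.uIcc (0 : ℝ) 1, HasDerivAt (fun s : ℝ => f (x + s • t • ee k))
      (t * dd k f (x + s • t • ee k)) s := by
    intro s _
    have h2 : HasDerivAt (fun s : ℝ => x + s • t • ee k) (t • ee k) s := by
      simpa using ((hasDerivAt_id s).smul_const (t • ee k)).const_add x
    have h3 : HasFDerivAt f (fderiv ℝ f (x + s • t • ee k)) (x + s • t • ee k) :=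
      (hf.differentiable (by norm_num) _).hasFDerivAt
    have := h3.comp_hasDerivAt s h2
    rw [map_smul, smul_eq_mul] at this
    exact this
  have h4 := intervalIntegral.integral_eq_sub_of_hasDerivAt h1 (by
    apply Continuous.intervalIntegrable
    have := dd_cont hf k
    fun_prop)
  simp only [one_smul, zero_smul, add_zero] at h4
  rw [← h4, intervalIntegral.integral_const_mul]
  rfl

/-- if `f` is close to `c` along the segment, so is the average. -/
lemma avg_close {f : E3 → ℝ} (hf : Continuous f) (z x : E3) {c τ : ℝ}
    (h : ∀ s : ℝ, 0 ≤ s → s ≤ 1 → |f (x + s • z) - c| ≤ τ) : |avg z f x - c| ≤ τ := by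
  have hi : IntervalIntegrable (fun s : ℝ => f (x + s • z)) volume 0 1 := by
    apply Continuous.intervalIntegrable; fun_prop
  have : avg z f x - c = ∫ s in (0 : ℝ)..1, (f (x + s • z) - c) := by
    rw [intervalIntegral.integral_sub hi (by simp)]
    simp [avg]
  rw [this]
  have := intervalIntegral.norm_integral_le_of_norm_le_const (a := 0) (b := 1) (C := τ)
    (f := fun s : ℝ => f (x + s • z) - c) (fun s hs => by
      rw [Set.uIoc_of_le zero_le_one] at hs
      exact h s hs.1.le hs.2)
  simpa using this

section
variable {h : ℝ → ℝ} {c₁ c₂ μ : ℝ}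

lemma DH_lip {n : ℕ} (hc₁ : 0 < c₁) (hc₂ : 0 < c₂) (hμ₁ : 1 < μ)
    (hreg : ContDiff ℝ 2 h) (h0' : deriv h 0 = 0)
    (hlow : ∀ t, 0 ≤ t → c₁ * (1 + t) ^ (-μ) ≤ min (deriv (deriv h) t) (slopeH h t))
    (hup : ∀ t, 0 ≤ t → max (deriv (deriv h) t) (slopeH h t) ≤ c₂ / (1 + t))
    (A B : Matrix (Fin n) (Fin n) ℝ) (i j : Fin n) :
    |DH h A i j - DH h B i j| ≤ c₂ * fnorm (A - B) := by
  have h1 := (DH_mono (n := n) hc₁ hc₂ hμ₁ hreg h0' hlow hup A B).2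
  set D := DH h A - DH h B with hD
  have h2 := frob_le D (A - B)
  have h3 : |D i j| ≤ fnorm D := by
    apply Real.abs_le_sqrt
    unfold frob
    calc D i j ^ 2 = D i j * D i j := by ring
      _ ≤ ∑ j, D i j * D i j :=
        Finset.single_le_sum (f := fun j => D i j * D i j) (fun _ _ => mul_self_nonneg _)
          (Finset.mem_univ j)
      _ ≤ _ := Finset.single_le_sum (f := fun i => ∑ j, D i j * D i j)
          (fun _ _ => Finset.sum_nonneg fun _ _ => mul_self_nonneg _)
          (Finset.mem_univ i)
  have h4 : fnorm D ≤ c₂ * fnorm (A - B) := by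
    rcases eq_or_lt_of_le (fnorm_nonneg D) with h5 | h5
    · rw [← h5]; have := fnorm_nonneg (A - B); positivity
    · rw [← fnorm_sq] at h1
      have : fnorm D * fnorm D ≤ fnorm D * (c₂ * fnorm (A - B)) := by nlinarith
      exact le_of_mul_le_mul_left this h5
  have h5 : DH h A i j - DH h B i j = D i j := rfl
  rw [h5]
  linarith
end

lemma cont_frob {A B : E3 → Matrix (Fin 3) (Fin 3) ℝ} (hA : ∀ i j, Continuous fun x => A x i j)
    (hB : ∀ i j, Continuous fun x => B x i j) : Continuous fun x => frob (A x) (B x) := by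
  unfold frob
  exact continuous_finsetSum _ fun i _ => continuous_finsetSum _ fun j _ => (hA i j).mul (hB i j)

lemma cont_fnorm {A : E3 → Matrix (Fin 3) (Fin 3) ℝ} (hA : ∀ i j, Continuous fun x => A x i j) :
    Continuous fun x => fnorm (A x) := (cont_frob hA hA).sqrt

/-- components -/
lemma pd_eq {u : E3 → E3} (hu : ContDiff ℝ 1 u) (j i : Fin 3) (x : E3) :
    pd u j x i = dd j (fun y => u y i) x := by
  have h1 : HasFDerivAt u (fderiv ℝ u x) x := (hu.differentiable (by norm_num) x).hasFDerivAt
  have h2 := (EuclideanSpace.proj (𝕜 := ℝ) i : E3 →L[ℝ] ℝ).hasFDerivAt.comp x h1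
  have h3 : fderiv ℝ (fun y => u y i) x
      = (EuclideanSpace.proj (𝕜 := ℝ) i : E3 →L[ℝ] ℝ).comp (fderiv ℝ u x) := h2.fderiv
  unfold dd
  rw [h3]
  rfl

lemma comp_contDiff {u : E3 → E3} {n : WithTop ℕ∞} (hu : ContDiff ℝ n u) (i : Fin 3) :
    ContDiff ℝ n (fun y => u y i) :=
  (EuclideanSpace.proj (𝕜 := ℝ) i : E3 →L[ℝ] ℝ).contDiff.comp hu

/-- weak formulation with `C¹` test functions -/
lemma weakC1 {S : E3 → Matrix (Fin 3) (Fin 3) ℝ} (hS : ∀ i j, Continuous fun x => S x i j)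
    (hsym : ∀ x i j, S x i j = S x j i)
    (hweak : ∀ φ : E3 → E3, ContDiff ℝ (⊤ : ℕ∞) φ → HasCompactSupport φ → (∀ x, divg φ x = 0) →
      (∫ x, frob (S x) (symGrad φ x)) = 0)
    {φ : Fin 3 → E3 → ℝ} (hφ : ∀ i, ContDiff ℝ 1 (φ i)) {r : ℝ}
    (hr : ∀ i x, r ≤ ‖x‖ → φ i x = 0) (hdiv : ∀ x, ∑ i, dd i (φ i) x = 0) :
    ∫ x, ∑ i, ∑ j, S x i j * dd j (φ i) x = 0 := by
  let Φ : E3 → E3 := fun x => WithLp.toLp 2 (fun i => φ i x)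
  have hΦ : ContDiff ℝ 1 Φ := by
    rw [contDiff_euclidean]; exact hφ
  have hΦr : ∀ x, r ≤ ‖x‖ → Φ x = 0 := by
    intro x hx
    ext i
    simpa [Φ] using hr i x hx
  have hΦpd : ∀ j i x, (fderiv ℝ Φ x (ee j)) i = dd j (φ i) x := fun j i x => pd_eq hΦ j i x
  let L : (E3 →L[ℝ] E3) →L[ℝ] ℝ :=
    ∑ k, (EuclideanSpace.proj (𝕜 := ℝ) k : E3 →L[ℝ] ℝ).comp (ContinuousLinearMap.apply ℝ E3 (ee k))
  have hL : ∀ T, L T = ∑ k, (T (ee k)) k := by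
    intro T
    simp [L, ContinuousLinearMap.sum_apply]
  obtain ⟨B, hB⟩ : ∃ B, ∀ x ∈ Metric.closedBall (0 : E3) (r + 2), ‖∑ i, ∑ j, |S x i j|‖ ≤ B := by
    refine (isCompact_closedBall (0 : E3) (r + 2)).exists_bound_of_continuousOn
      (Continuous.continuousOn ?_)
    exact continuous_finsetSum _ fun i _ => continuous_finsetSum _ fun j _ => (hS i j).abs
  have hc2 : Continuous fun x => ∑ i, ∑ j, S x i j * dd j (φ i) x :=
    continuous_finsetSum _ fun i _ => continuous_finsetSum _ fun j _ =>
      (hS i j).mul (dd_cont (hφ i) j)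
  have z2 : ∀ x, r + 2 ≤ ‖x‖ → ∑ i, ∑ j, S x i j * dd j (φ i) x = 0 := fun x hx =>
    Finset.sum_eq_zero fun i _ => Finset.sum_eq_zero fun j _ => by
      rw [dd_zero_of (hr i) j x (by linarith)]; simp
  set V := volume.real (Metric.ball (0 : E3) (r + 2))
  have key : ∀ τ > 0, |∫ x, ∑ i, ∑ j, S x i j * dd j (φ i) x| ≤ τ * (|B| * V) := by
    intro τ hτ
    obtain ⟨g, hg, hgr, hgd, hgL⟩ := approx hΦ hΦr hτ
    have hg1 : ContDiff ℝ 1 g := contDiff_infty.1 hg 1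
    have hgr' : ∀ i x, r + 1 ≤ ‖x‖ → g x i = 0 := fun i x hx => by rw [hgr x hx]; rfl
    have w0 := hweak g hg (hcs_of hgr) (fun x => by
      have := hgL L (fun x => by
        rw [hL, ← hdiv x]
        exact Finset.sum_congr rfl fun k _ => hΦpd k k x) x
      rw [hL] at this
      exact this)
    have hfe : ∀ x, frob (S x) (symGrad g x) = ∑ i, ∑ j, S x i j * dd j (fun y => g y i) x := by
      intro x
      unfold frob symGrad
      simp only [pd_eq hg1]
      have : ∀ a b, S x a b * ((dd b (fun y => g y a) x + dd a (fun y => g y b) x) / 2)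
        = S x a b * dd b (fun y => g y a) x / 2 + S x b a * dd a (fun y => g y b) x / 2 := by
        intro a b; rw [hsym x b a]; ring
      simp only [this, Finset.sum_add_distrib]
      rw [Finset.sum_comm (f := fun a b => S x b a * dd a (fun y => g y b) x / 2),
        ← Finset.sum_add_distrib]
      refine Finset.sum_congr rfl fun i _ => ?_
      rw [← Finset.sum_add_distrib]
      exact Finset.sum_congr rfl fun i _ => by ring
    simp only [hfe] at w0
    have hc1 : Continuous fun x => ∑ i, ∑ j, S x i j * dd j (fun y => g y i) x :=
      continuous_finsetSum _ fun i _ => continuous_finsetSum _ fun j _ =>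
        (hS i j).mul (dd_cont (comp_contDiff hg1 i) j)
    have z1 : ∀ x, r + 2 ≤ ‖x‖ → ∑ i, ∑ j, S x i j * dd j (fun y => g y i) x = 0 := fun x hx =>
      Finset.sum_eq_zero fun i _ => Finset.sum_eq_zero fun j _ => by
        rw [dd_zero_of (hgr' i) j x (by linarith)]; simp
    have := int_diff (τ := τ * |B|) (int_cs hc2 z2) (int_cs hc1 z1) z2 z1 (by
      intro x hx
      rw [← Finset.sum_sub_distrib]
      simp only [← Finset.sum_sub_distrib, ← mul_sub]
      calc |∑ i, ∑ j, S x i j * (dd j (φ i) x - dd j (fun y => g y i) x)|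
          ≤ ∑ i, ∑ j, |S x i j * (dd j (φ i) x - dd j (fun y => g y i) x)| :=
            (Finset.abs_sum_le_sum_abs _ _).trans
              (Finset.sum_le_sum fun i _ => Finset.abs_sum_le_sum_abs _ _)
        _ ≤ ∑ i, ∑ j, |S x i j| * τ := by
            refine Finset.sum_le_sum fun i _ => Finset.sum_le_sum fun j _ => ?_
            rw [abs_mul]
            refine mul_le_mul_of_nonneg_left ?_ (abs_nonneg _)
            rw [← hΦpd j i x, ← pd_eq hg1 j i x, abs_sub_comm]
            have h1 := ContinuousLinearMap.le_opNorm (fderiv ℝ g x - fderiv ℝ Φ x) (ee j)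
            rw [norm_ee, mul_one] at h1
            have h2 := PiLp.norm_apply_le ((fderiv ℝ g x - fderiv ℝ Φ x) (ee j)) i
            exact (h2.trans h1).trans (hgd x)
        _ = τ * ∑ i, ∑ j, |S x i j| := by
            simp only [Finset.mul_sum, mul_comm]
        _ ≤ τ * |B| := by
            refine mul_le_mul_of_nonneg_left ?_ hτ.le
            exact (le_abs_self _).trans ((hB x (by simp; linarith)).trans (le_abs_self _)))
    rw [w0, sub_zero] at this
    linarith
  have hV : 0 ≤ |B| * V := by positivity
  have : |∫ x, ∑ i, ∑ j, S x i j * dd j (φ i) x| ≤ 0 := by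
    apply le_of_forall_pos_le_add
    intro η hη
    have := key (η / (|B| * V + 1)) (by positivity)
    refine this.trans ?_
    rw [zero_add, div_mul_eq_mul_div, div_le_iff₀ (by positivity)]
    nlinarith
  exact abs_nonpos_iff.1 this

end

section
open MeasureTheory Real Filter

lemma dd_scale {f : E3 → ℝ} (hf : Differentiable ℝ f) (c : ℝ) (j : Fin 3) (x : E3) :
    dd j (fun y => f (c • y)) x = c * dd j f (c • x) := by
  have h1 : HasFDerivAt f (fderiv ℝ f (c • x)) (c • x) := (hf _).hasFDerivAt
  have h2 : HasFDerivAt (fun y : E3 => c • y) (c • ContinuousLinearMap.id ℝ E3) x :=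
    (hasFDerivAt_id x).const_smul c
  have h3 := (h1.comp x h2).fderiv
  unfold dd
  rw [show (fun y => f (c • y)) = f ∘ (fun y : E3 => c • y) from rfl, h3]
  simp

lemma dd_const_mul {f : E3 → ℝ} (hf : Differentiable ℝ f) (c : ℝ) (j : Fin 3) (x : E3) :
    dd j (fun y => c * f y) x = c * dd j f x := by
  unfold dd
  rw [fderiv_const_mul (hf x)]
  simp

lemma dd_add {f g : E3 → ℝ} (hf : Differentiable ℝ f) (hg : Differentiable ℝ g) (j : Fin 3) (x : E3) :
    dd j (fun y => f y + g y) x = dd j f x + dd j g x := by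
  unfold dd
  rw [show (fun y => f y + g y) = f + g from rfl, fderiv_add (hf x) (hg x)]
  simp

lemma dd_sub {f g : E3 → ℝ} (hf : Differentiable ℝ f) (hg : Differentiable ℝ g) (j : Fin 3) (x : E3) :
    dd j (fun y => f y - g y) x = dd j f x - dd j g x := by
  unfold dd
  rw [show (fun y => f y - g y) = f - g from rfl, fderiv_sub (hf x) (hg x)]
  simp

lemma dd_sum {f : Fin 3 → E3 → ℝ} (hf : ∀ l, Differentiable ℝ (f l)) (j : Fin 3) (x : E3) :
    dd j (fun y => ∑ l, f l y) x = ∑ l, dd j (f l) x := by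
  unfold dd
  rw [fderiv_fun_sum (fun l _ => hf l x)]
  simp

lemma dd_shift {f : E3 → ℝ} (z : E3) (j : Fin 3) (x : E3) :
    dd j (fun y => f (y + z)) x = dd j f (x + z) := by
  unfold dd
  rw [fderiv_comp_add_right]

lemma dd_pow {f : E3 → ℝ} (hf : Differentiable ℝ f) (n : ℕ) (j : Fin 3) (x : E3) :
    dd j (fun y => f y ^ (n + 1)) x = (n + 1 : ℝ) * f x ^ n * dd j f x := by
  unfold dd
  rw [((hf x).hasFDerivAt.pow (n + 1)).fderiv]
  simp

lemma cutoff_exists : ∃ N : ℝ, 1 ≤ N ∧ ∀ R : ℝ, 1 ≤ R → ∃ ζ : E3 → ℝ, ContDiff ℝ (⊤ : ℕ∞) ζ ∧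
    (∀ x, 0 ≤ ζ x) ∧ (∀ x, ζ x ≤ 1) ∧ (∀ x, ‖x‖ ≤ R → ζ x = 1) ∧ (∀ x, 2 * R ≤ ‖x‖ → ζ x = 0) ∧
    (∀ j x, |dd j ζ x| ≤ N / R) ∧ (∀ i j x, |dd i (dd j ζ) x| ≤ (N / R) ^ 2) ∧
    ∫ x, ζ x ≤ N * R ^ 3 := by
  let ψ : ContDiffBump (0 : E3) := ⟨1, 2, by norm_num, by norm_num⟩
  have hψ : ContDiff ℝ (⊤ : ℕ∞) ψ := ψ.contDiff
  have hψ1 : ContDiff ℝ 1 ψ := ψ.contDiff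
  have hψ0 : ∀ x : E3, 2 ≤ ‖x‖ → ψ x = 0 := fun x hx => ψ.zero_of_le_dist (by simpa [ψ] using hx)
  have hd : ∀ j, ContDiff ℝ (⊤ : ℕ∞) (dd j ψ) := fun j => dd_contDiff (n := ⊤) (by simpa using hψ) j
  have hb : ∀ f : E3 → ℝ, Continuous f → (∃ r : ℝ, ∀ x : E3, r ≤ ‖x‖ → f x = 0) → ∃ B : ℝ, 0 ≤ B ∧ ∀ x, |f x| ≤ B := by
    rintro f hf ⟨r, hr⟩
    obtain ⟨B, hB⟩ := (hcs_of hr).exists_bound_of_continuous hf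
    exact ⟨|B|, abs_nonneg _, fun x => (hB x).trans (le_abs_self _)⟩
  have hz1 : ∀ j, ∀ x : E3, 3 ≤ ‖x‖ → dd j ψ x = 0 :=
    fun j x hx => dd_zero_of hψ0 j x (by linarith)
  have hz2 : ∀ i j, ∀ x : E3, 4 ≤ ‖x‖ → dd i (dd j ψ) x = 0 :=
    fun i j x hx => dd_zero_of (hz1 j) i x (by linarith)
  choose B1 hB10 hB1 using fun j => hb (dd j ψ) (hd j).continuous ⟨3, hz1 j⟩
  choose B2 hB20 hB2 using fun i j => hb (dd i (dd j ψ))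
    (dd_cont (contDiff_infty.1 (hd j) 1) i) ⟨4, hz2 i j⟩
  have hI : 0 ≤ ∫ x, ψ x := integral_nonneg fun x => ψ.nonneg
  have hS1 : 0 ≤ ∑ j, B1 j := Finset.sum_nonneg fun j _ => hB10 j
  have hS2 : 0 ≤ ∑ i, ∑ j, B2 i j := Finset.sum_nonneg fun i _ => Finset.sum_nonneg fun j _ => hB20 i j
  set N : ℝ := 1 + ∑ j, B1 j + ∑ i, ∑ j, B2 i j + ∫ x, ψ x with hN
  have hN1 : 1 ≤ N := by linarith
  have hNB1 : ∀ j, B1 j ≤ N := fun j => by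
    have := Finset.single_le_sum (f := B1) (fun j _ => hB10 j) (Finset.mem_univ j)
    linarith
  have hNB2 : ∀ i j, B2 i j ≤ N := fun i j => by
    have h1 := Finset.single_le_sum (f := B2 i) (fun j _ => hB20 i j) (Finset.mem_univ j)
    have h2 := Finset.single_le_sum (f := fun i => ∑ j, B2 i j)
      (fun i _ => Finset.sum_nonneg fun j _ => hB20 i j) (Finset.mem_univ i)
    linarith
  refine ⟨N, hN1, fun R hR => ?_⟩
  have hR0 : 0 < R := by linarith
  have hdψ : Differentiable ℝ ψ := hψ1.differentiable (by norm_num)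
  have e1 : ∀ j, dd j (fun x => ψ (R⁻¹ • x)) = fun x => R⁻¹ * dd j ψ (R⁻¹ • x) := fun j =>
    funext fun x => dd_scale hdψ R⁻¹ j x
  have hdd : ∀ j, Differentiable ℝ (dd j ψ) := fun j =>
    (contDiff_infty.1 (hd j) 1).differentiable (by norm_num)
  have e2 : ∀ i j x, dd i (dd j (fun x => ψ (R⁻¹ • x))) x
      = R⁻¹ * (R⁻¹ * dd i (dd j ψ) (R⁻¹ • x)) := by
    intro i j x
    rw [e1, dd_const_mul (f := fun x => dd j ψ (R⁻¹ • x))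
      ((hdd j).comp (by fun_prop : Differentiable ℝ fun x : E3 => R⁻¹ • x)), dd_scale (hdd j)]
  have hn : ∀ x : E3, ‖R⁻¹ • x‖ = ‖x‖ / R := fun x => by
    rw [norm_smul, Real.norm_eq_abs, abs_of_pos (by positivity)]; field_simp
  refine ⟨fun x => ψ (R⁻¹ • x), hψ.comp (by fun_prop), fun x => ψ.nonneg, fun x => ψ.le_one,
    fun x hx => ψ.one_of_mem_closedBall ?_, fun x hx => hψ0 _ ?_, ?_, ?_, ?_⟩
  · rw [mem_closedBall_zero_iff, hn]
    simp only [ψ]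
    rw [div_le_one hR0]; exact hx
  · rw [hn, le_div_iff₀ hR0]; exact hx
  · intro j x
    rw [e1]
    simp only
    rw [abs_mul, abs_of_pos (by positivity), inv_mul_eq_div]
    exact div_le_div_of_nonneg_right ((hB1 j _).trans (hNB1 j)) hR0.le
  · intro i j x
    rw [e2, ← mul_assoc, abs_mul, abs_of_pos (by positivity)]
    have := (hB2 i j (R⁻¹ • x)).trans (hNB2 i j)
    have h3 : N ≤ N ^ 2 := by nlinarith
    calc R⁻¹ * R⁻¹ * |dd i (dd j ψ) (R⁻¹ • x)| ≤ R⁻¹ * R⁻¹ * N ^ 2 :=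
          mul_le_mul_of_nonneg_left (this.trans h3) (by positivity)
      _ = _ := by field_simp
  · rw [Measure.integral_comp_smul (volume : Measure E3) ψ R⁻¹]
    simp only [finrank_euclideanSpace, Fintype.card_fin, smul_eq_mul]
    rw [abs_of_pos (by positivity), inv_pow, inv_inv, mul_comm]
    exact mul_le_mul_of_nonneg_right (by linarith) (by positivity)

/-- bounds for the derivatives of powers of the cutoff -/
lemma cutoff_pow {ζ : E3 → ℝ} (hζ : ContDiff ℝ (⊤ : ℕ∞) ζ) (h0 : ∀ x, 0 ≤ ζ x) (h1 : ∀ x, ζ x ≤ 1)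
    {κ : ℝ} (hd : ∀ j x, |dd j ζ x| ≤ κ) (hdd : ∀ i j x, |dd i (dd j ζ) x| ≤ κ ^ 2) (n : ℕ) :
    (∀ j x, |dd j (fun y => ζ y ^ (n + 1)) x| ≤ (n + 1) * κ * ζ x ^ n) ∧
    (∀ i j x, |dd i (dd j (fun y => ζ y ^ (n + 2))) x| ≤ (n + 2) ^ 2 * κ ^ 2 * ζ x ^ n) := by
  have hD : Differentiable ℝ ζ := (contDiff_infty.1 hζ 1).differentiable (by norm_num)
  have hDD : ∀ j, Differentiable ℝ (dd j ζ) := fun j =>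
    (dd_contDiff (n := 1) (contDiff_infty.1 hζ 2) j).differentiable (by norm_num)
  constructor
  · intro j x
    have := h0 x
    rw [dd_pow hD, abs_mul, abs_of_nonneg (by positivity)]
    calc ((n : ℝ) + 1) * ζ x ^ n * |dd j ζ x| ≤ ((n : ℝ) + 1) * ζ x ^ n * κ :=
          mul_le_mul_of_nonneg_left (hd j x) (by positivity)
      _ = _ := by ring
  · intro i j x
    have hx := h0 x
    have hκ : 0 ≤ κ := (abs_nonneg _).trans (hd i x)
    have e : dd j (fun y => ζ y ^ (n + 2)) = fun y => ((n : ℝ) + 2) * (ζ y ^ (n + 1) * dd j ζ y) := by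
      funext y
      rw [dd_pow hD (n + 1)]
      push_cast; ring
    have hp : Differentiable ℝ fun y => ζ y ^ (n + 1) := hD.pow _
    rw [e, dd_const_mul (f := fun y => ζ y ^ (n + 1) * dd j ζ y) (hp.mul (hDD j)), dd_mul hp (hDD j), dd_pow hD, abs_mul,
      abs_of_nonneg (by positivity)]
    have a1 : |ζ x ^ (n + 1) * dd i (dd j ζ) x| ≤ ζ x ^ n * κ ^ 2 := by
      rw [abs_mul, abs_of_nonneg (by positivity)]
      exact mul_le_mul (pow_le_pow_of_le_one hx (h1 x) (by omega)) (hdd i j x) (abs_nonneg _)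
        (by positivity)
    have a2 : |((n : ℝ) + 1) * ζ x ^ n * dd i ζ x * dd j ζ x| ≤ ((n : ℝ) + 1) * ζ x ^ n * κ * κ := by
      rw [abs_mul, abs_mul, abs_of_nonneg (a := ((n : ℝ) + 1) * ζ x ^ n) (by positivity)]
      gcongr
      · exact hd i x
      · exact hd j x
    have a3 := (abs_add_le (ζ x ^ (n + 1) * dd i (dd j ζ) x)
      (((n : ℝ) + 1) * ζ x ^ n * dd i ζ x * dd j ζ x)).trans (add_le_add a1 a2)
    calc ((n : ℝ) + 2) * |ζ x ^ (n + 1) * dd i (dd j ζ) x + ((n : ℝ) + 1) * ζ x ^ n * dd i ζ x * dd j ζ x|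
        ≤ ((n : ℝ) + 2) * (ζ x ^ n * κ ^ 2 + ((n : ℝ) + 1) * ζ x ^ n * κ * κ) :=
          mul_le_mul_of_nonneg_left a3 (by positivity)
      _ = _ := by ring

/-- uniform continuity on balls -/
lemma unif_ball {f : E3 → ℝ} (hf : Continuous f) (r : ℝ) {η : ℝ} (hη : 0 < η) :
    ∃ δ > 0, ∀ x, ‖x‖ ≤ r → ∀ z, ‖z‖ ≤ δ → |f (x + z) - f x| ≤ η := by
  have := (isCompact_closedBall (0 : E3) (r + 1)).uniformContinuousOn_of_continuous hf.continuousOn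
  obtain ⟨δ, hδ, h⟩ := Metric.uniformContinuousOn_iff.1 this η hη
  refine ⟨min (δ / 2) 1, by positivity, fun x hx z hz => ?_⟩
  have hz1 := hz.trans (min_le_left _ _)
  have hz2 := hz.trans (min_le_right _ _)
  refine (h (x + z) ?_ x ?_ ?_).le
  · rw [mem_closedBall_zero_iff]; linarith [norm_add_le x z]
  · rw [mem_closedBall_zero_iff]; linarith
  · rw [dist_eq_norm, add_sub_cancel_left]; linarith

lemma unif_ev {f : E3 → ℝ} (hf : Continuous f) (r : ℝ) {η : ℝ} (hη : 0 < η) :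
    ∀ᶠ t in nhdsWithin (0 : ℝ) (Set.Ioi 0), ∀ x, ‖x‖ ≤ r → ∀ k, ∀ s : ℝ, |s| ≤ 1 →
      |f (x + s • t • ee k) - f x| ≤ η := by
  obtain ⟨δ, hδ, h⟩ := unif_ball hf r hη
  filter_upwards [Ioo_mem_nhdsGT hδ] with t ht x hx k s hs
  refine h x hx _ ?_
  rw [norm_smul, norm_smul, norm_ee, Real.norm_eq_abs, Real.norm_eq_abs, abs_of_pos ht.1]
  nlinarith [ht.1, ht.2, abs_nonneg s]

/-- difference quotients converge uniformly on balls -/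
lemma diffq_ev {g : E3 → ℝ} (hg : ContDiff ℝ 1 g) (r : ℝ) {η : ℝ} (hη : 0 < η) (k : Fin 3) :
    ∀ᶠ t in nhdsWithin (0 : ℝ) (Set.Ioi 0), ∀ x, ‖x‖ ≤ r →
      |(g (x + t • ee k) - g x) / t - dd k g x| ≤ η ∧ |(g x - g (x - t • ee k)) / t - dd k g x| ≤ η := by
  filter_upwards [unif_ev (dd_cont hg k) r hη, self_mem_nhdsWithin] with t ht ht0 x hx
  have ht0 : 0 < t := ht0
  constructor
  · rw [← avg_diff hg, mul_div_cancel_left₀ _ ht0.ne']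
    refine avg_close (dd_cont hg k) _ _ fun s h0 h1 => ht x hx k s ?_
    rw [abs_of_nonneg h0]; exact h1
  · have := avg_diff hg k (-t) x
    have e : (g x - g (x - t • ee k)) / t = avg ((-t) • ee k) (dd k g) x := by
      rw [neg_smul, ← sub_eq_add_neg] at this
      rw [neg_smul]
      field_simp
      linarith
    rw [e]
    refine avg_close (dd_cont hg k) _ _ fun s h0 h1 => ?_
    have := ht x hx k (-s) (by rw [abs_neg, abs_of_nonneg h0]; exact h1)
    rw [neg_smul s, ← smul_neg, ← neg_smul] at this
    exact this

end

section
open MeasureTheory Real Filter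

/-- the lower order part of the gradient of the test function -/
noncomputable def restT (θ : E3 → ℝ) (U : Fin 3 → E3 → ℝ) (k : Fin 3) (t : ℝ) (i j : Fin 3) (x : E3) : ℝ :=
  dd j θ x * avg (t • ee k) (dd k (U i)) x + dd j (dd k θ) x * avg (t • ee k) (U i) x
    + dd k θ x * avg (t • ee k) (dd j (U i)) x
    - (if i = k then (1 : ℝ) else 0) * ∑ l, (dd j (dd l θ) x * avg (t • ee k) (U l) x
        + dd l θ x * avg (t • ee k) (dd j (U l)) x)

/-- weak formulation for `C¹` test functions -/
def WeakC1 (S : E3 → Matrix (Fin 3) (Fin 3) ℝ) : Prop :=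
  ∀ φ : Fin 3 → E3 → ℝ, (∀ i, ContDiff ℝ 1 (φ i)) → (∃ r : ℝ, ∀ i x, r ≤ ‖x‖ → φ i x = 0) →
    (∀ x, ∑ i, dd i (φ i) x = 0) → ∫ x, ∑ i, ∑ j, S x i j * dd j (φ i) x = 0

lemma cacc_id {U : Fin 3 → E3 → ℝ} (hU : ∀ i, ContDiff ℝ 1 (U i)) (hdiv : ∀ x, ∑ i, dd i (U i) x = 0)
    {S : E3 → Matrix (Fin 3) (Fin 3) ℝ} (hS : ∀ i j, Continuous fun x => S x i j)
    (hW : WeakC1 S) {θ : E3 → ℝ} (hθ : ContDiff ℝ 2 θ) {r : ℝ} (hr : ∀ x, r ≤ ‖x‖ → θ x = 0)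
    (k : Fin 3) {t : ℝ} (ht : 0 < t) :
    (∀ i j, Continuous (restT θ U k t i j)) ∧ (∀ i j x, r + 2 ≤ ‖x‖ → restT θ U k t i j x = 0) ∧
    ∫ x, ∑ i, ∑ j, (S (x + t • ee k) i j - S x i j) *
      (θ x * ((dd j (U i) (x + t • ee k) - dd j (U i) x) / t) + restT θ U k t i j x) = 0 := by
  set z := t • ee k with hz
  have hθd : ∀ l, ContDiff ℝ 1 (dd l θ) := fun l => dd_contDiff (n := 1) (by simpa [one_add_one_eq_two] using hθ) l
  have hθ1 : ContDiff ℝ 1 θ := hθ.of_le (by norm_num)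
  have hV : ∀ i, ContDiff ℝ 1 (avg z (U i)) := fun i => avg_contDiff (hU i) z
  have hUs : ∀ i, ContDiff ℝ 1 (fun x => U i (x + z)) := fun i => (hU i).comp (by fun_prop)
  have hcr : ∀ i j, Continuous (restT θ U k t i j) := by
    intro i j
    unfold restT
    refine Continuous.sub (Continuous.add (Continuous.add ?_ ?_) ?_)
      (continuous_const.mul (continuous_finsetSum _ fun l _ => Continuous.add ?_ ?_))
    · exact (dd_cont hθ1 j).mul (avg_cont (dd_cont (hU i) k) z)
    · exact (dd_cont (hθd k) j).mul (avg_cont (hU i).continuous z)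
    · exact (dd_cont hθ1 k).mul (avg_cont (dd_cont (hU i) j) z)
    · exact (dd_cont (hθd l) j).mul (avg_cont (hU l).continuous z)
    · exact (dd_cont hθ1 l).mul (avg_cont (dd_cont (hU l) j) z)
  have z1 : ∀ l x, r + 1 ≤ ‖x‖ → dd l θ x = 0 := fun l x hx => dd_zero_of hr l x (by linarith)
  have z2 : ∀ j l x, r + 2 ≤ ‖x‖ → dd j (dd l θ) x = 0 := fun j l x hx =>
    dd_zero_of (z1 l) j x (by linarith)
  refine ⟨hcr, ?_, ?_⟩
  · intro i j x hx
    unfold restT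
    have h2 : r + 1 ≤ ‖x‖ := by linarith
    simp [z1 _ x h2, z2 _ _ x hx]
  -- the test function
  let Q : Fin 3 → E3 → ℝ := fun i x => t⁻¹ * (U i (x + z) - U i x)
  have hQ : ∀ i, ContDiff ℝ 1 (Q i) := fun i => contDiff_const.mul ((hUs i).sub (hU i))
  have hQavg : ∀ i x, Q i x = avg z (dd k (U i)) x := by
    intro i x
    simp only [Q]
    rw [← avg_diff (hU i) k t x, inv_mul_cancel_left₀ ht.ne']
  have hQd : ∀ i j x, dd j (Q i) x = (dd j (U i) (x + z) - dd j (U i) x) / t := by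
    intro i j x
    rw [dd_const_mul (f := fun x => U i (x + z) - U i x)
      (((hUs i).sub (hU i)).differentiable (by norm_num)),
      dd_sub ((hUs i).differentiable (by norm_num)) ((hU i).differentiable (by norm_num)),
      dd_shift]
    field_simp
  have hVd : ∀ i j x, dd j (avg z (U i)) x = avg z (dd j (U i)) x := fun i j x => avg_dd (hU i) z j x
  let W : E3 → ℝ := fun x => ∑ l, dd l θ x * avg z (U l) x
  have hWc : ContDiff ℝ 1 W := ContDiff.sum fun l _ => (hθd l).mul (hV l)
  have hWd : ∀ j x, dd j W x = ∑ l, (dd j (dd l θ) x * avg z (U l) x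
        + dd l θ x * avg z (dd j (U l)) x) := by
    intro j x
    rw [dd_sum (f := fun l x => dd l θ x * avg z (U l) x)
      (fun l => ((hθd l).mul (hV l)).differentiable (by norm_num))]
    refine Finset.sum_congr rfl fun l _ => ?_
    rw [dd_mul ((hθd l).differentiable (by norm_num)) ((hV l).differentiable (by norm_num)), hVd]
    ring
  let c : Fin 3 → ℝ := fun i => if i = k then (1 : ℝ) else 0
  let Ψ : Fin 3 → E3 → ℝ := fun i x => θ x * Q i x + dd k θ x * avg z (U i) x - c i * W x
  have hΨ : ∀ i, ContDiff ℝ 1 (Ψ i) := fun i =>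
    ((hθ1.mul (hQ i)).add ((hθd k).mul (hV i))).sub (contDiff_const.mul hWc)
  have hΨd : ∀ i j x, dd j (Ψ i) x
      = θ x * ((dd j (U i) (x + z) - dd j (U i) x) / t) + restT θ U k t i j x := by
    intro i j x
    have a1 : Differentiable ℝ fun x => θ x * Q i x := (hθ1.mul (hQ i)).differentiable (by norm_num)
    have a2 : Differentiable ℝ fun x => dd k θ x * avg z (U i) x :=
      ((hθd k).mul (hV i)).differentiable (by norm_num)
    have a3 : Differentiable ℝ fun x => c i * W x :=
      (contDiff_const.mul hWc).differentiable (by norm_num)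
    have : dd j (Ψ i) x = dd j (fun x => θ x * Q i x) x + dd j (fun x => dd k θ x * avg z (U i) x) x
        - dd j (fun x => c i * W x) x := by
      rw [← dd_add a1 a2, ← dd_sub (f := fun x => θ x * Q i x + dd k θ x * avg z (U i) x) (a1.add a2) a3]
    rw [this, dd_mul (hθ1.differentiable (by norm_num)) ((hQ i).differentiable (by norm_num)),
      dd_mul ((hθd k).differentiable (by norm_num)) ((hV i).differentiable (by norm_num)),
      dd_const_mul (hWc.differentiable (by norm_num)), hWd, hQd, hVd, hQavg]
    unfold restT
    simp only [c, ← hz]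
    ring
  have hΨr : ∀ i x, r + 1 ≤ ‖x‖ → Ψ i x = 0 := by
    intro i x hx
    simp [Ψ, W, z1 _ x hx, hr x (by linarith)]
  have hΨdiv : ∀ x, ∑ i, dd i (Ψ i) x = 0 := by
    intro x
    simp only [hΨd]
    have d1 := hdiv (x + z)
    have d2 := hdiv x
    have d3 : ∑ i, avg z (dd i (U i)) x = 0 := by
      have : ∀ s : ℝ, ∑ i, dd i (U i) (x + s • z) = 0 := fun s => hdiv _
      unfold avg
      rw [← intervalIntegral.integral_finsetSum]
      · simp [this]
      · intro i _
        apply Continuous.intervalIntegrable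
        have := dd_cont (hU i) i
        fun_prop
    have e1 : ∑ i, θ x * ((dd i (U i) (x + z) - dd i (U i) x) / t) = 0 := by
      rw [← Finset.mul_sum, ← Finset.sum_div, Finset.sum_sub_distrib, d1, d2]; simp
    rw [Finset.sum_add_distrib, e1, zero_add]
    unfold restT
    rw [Finset.sum_sub_distrib, Finset.sum_add_distrib, Finset.sum_add_distrib]
    rw [← Finset.mul_sum _ _ (dd k θ x), ← hz, d3]
    simp only [ite_mul, one_mul, zero_mul, Finset.sum_ite_eq', Finset.mem_univ, if_true]
    rw [Finset.sum_add_distrib]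
    simp only [dd_swap hθ k]
    ring
  have w1 := hW Ψ hΨ ⟨_, hΨr⟩ hΨdiv
  have w2 := hW (fun i x => Ψ i (x + (-z))) (fun i => (hΨ i).comp (by fun_prop))
    ⟨r + 1 + ‖z‖, fun i x hx => hΨr i _ (by
      have := norm_sub_norm_le x z
      rw [← sub_eq_add_neg]; linarith)⟩ (fun x => by
      simp only [dd_shift]; exact hΨdiv _)
  simp only [dd_shift] at w2
  rw [← integral_add_right_eq_self _ z] at w2
  simp only [add_neg_cancel_right] at w2
  have hcts : ∀ y : E3, Continuous fun x => ∑ i, ∑ j, S (x + y) i j * dd j (Ψ i) x := fun y =>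
    continuous_finsetSum _ fun i _ => continuous_finsetSum _ fun j _ =>
      ((hS i j).comp (by fun_prop : Continuous fun x : E3 => x + y)).mul (dd_cont (hΨ i) j)
  have hsup : ∀ y x : E3, r + 2 ≤ ‖x‖ → ∑ i, ∑ j, S (x + y) i j * dd j (Ψ i) x = 0 := by
    intro y x hx
    refine Finset.sum_eq_zero fun i _ => Finset.sum_eq_zero fun j _ => ?_
    rw [dd_zero_of (hΨr i) j x (by linarith), mul_zero]
  have i1 := int_cs (hcts z) (hsup z)
  have i0 := int_cs (hcts 0) (hsup 0)
  simp only [add_zero] at i0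
  have := integral_sub i1 i0
  rw [w1, w2, sub_zero] at this
  rw [← this]
  congr 1
  funext x
  rw [← Finset.sum_sub_distrib]
  refine Finset.sum_congr rfl fun i _ => ?_
  rw [← Finset.sum_sub_distrib]
  refine Finset.sum_congr rfl fun j _ => ?_
  rw [hΨd, sub_mul]

end

section
open MeasureTheory Real Filter

/-- symmetric gradient -/
noncomputable def eps (U : Fin 3 → E3 → ℝ) (x : E3) : Matrix (Fin 3) (Fin 3) ℝ :=
  fun i j => (dd j (U i) x + dd i (U j) x) / 2

/-- square of the full gradient -/
noncomputable def gsq (U : Fin 3 → E3 → ℝ) (x : E3) : ℝ := ∑ i, ∑ j, dd j (U i) x ^ 2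

lemma le_sum2 (f : Fin 3 → Fin 3 → ℝ) (hf : ∀ i j, 0 ≤ f i j) (i j : Fin 3) : f i j ≤ ∑ i, ∑ j, f i j :=
  (Finset.single_le_sum (f := f i) (fun j _ => hf i j) (Finset.mem_univ j)).trans
    (Finset.single_le_sum (f := fun i => ∑ j, f i j)
      (fun i _ => Finset.sum_nonneg fun j _ => hf i j) (Finset.mem_univ i))

lemma gsq_nonneg (U : Fin 3 → E3 → ℝ) (x : E3) : 0 ≤ gsq U x :=
  Finset.sum_nonneg fun _ _ => Finset.sum_nonneg fun _ _ => sq_nonneg _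

lemma dd_sq_le_gsq (U : Fin 3 → E3 → ℝ) (x : E3) (i j : Fin 3) : dd j (U i) x ^ 2 ≤ gsq U x :=
  le_sum2 (fun i j => dd j (U i) x ^ 2) (fun _ _ => sq_nonneg _) i j

lemma frob_eps_sym {G : Matrix (Fin 3) (Fin 3) ℝ} (hG : ∀ i j, G i j = G j i)
    (D : Fin 3 → Fin 3 → ℝ) : ∑ i, ∑ j, G i j * D i j = frob G (fun i j => (D i j + D j i) / 2) := by
  unfold frob
  have : ∀ i j, G i j * ((D i j + D j i) / 2) = G i j * D i j / 2 + G j i * D j i / 2 := by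
    intro i j; rw [hG j i]; ring
  simp only [this, Finset.sum_add_distrib]
  rw [Finset.sum_comm (f := fun i j => G j i * D j i / 2), ← Finset.sum_add_distrib]
  refine Finset.sum_congr rfl fun i _ => ?_
  rw [← Finset.sum_add_distrib]
  exact Finset.sum_congr rfl fun i _ => by ring

lemma restT_bound {U : Fin 3 → E3 → ℝ} (hU : ∀ i, ContDiff ℝ 1 (U i))
    {ζ : E3 → ℝ} (hζ : ContDiff ℝ (⊤ : ℕ∞) ζ) (h0 : ∀ x, 0 ≤ ζ x) (h1 : ∀ x, ζ x ≤ 1)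
    {κ M r t : ℝ} (hr : ∀ x, r ≤ ‖x‖ → ζ x = 0) (hκ : 0 < κ) (hM : 0 < M)
    (hd : ∀ j x, |dd j ζ x| ≤ κ) (hdd : ∀ i j x, |dd i (dd j ζ) x| ≤ κ ^ 2) (m : ℕ)
    (hUM : ∀ i x, ‖x‖ ≤ r + 1 → |U i x| ≤ M) (ht : 0 < t) (ht1 : t ≤ 1)
    (hcl : ∀ i j x, ‖x‖ ≤ r → ∀ k, ∀ s : ℝ, |s| ≤ 1 →
      |dd j (U i) (x + s • t • ee k) - dd j (U i) x| ≤ κ * M) (k i j : Fin 3) (x : E3) :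
    ∃ b, 0 ≤ b ∧ |restT (fun y => ζ y ^ (m + 4)) U k t i j x| ≤ ζ x ^ (m + 2) * b ∧
      b ^ 2 ≤ 150 * (m + 4) ^ 4 * κ ^ 2 * (ζ x ^ 2 * gsq U x + κ ^ 2 * M ^ 2) := by
  have p1 := (cutoff_pow hζ h0 h1 hd hdd (m + 3)).1
  have p2 := (cutoff_pow hζ h0 h1 hd hdd (m + 2)).2
  push_cast at p1 p2
  rw [show m + 3 + 1 = m + 4 from rfl] at p1
  rw [show m + 2 + 2 = m + 4 from rfl] at p2
  set θ : E3 → ℝ := fun y => ζ y ^ (m + 4) with hθ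
  set q : ℝ := (m : ℝ) + 4 with hq
  have hq4 : 4 ≤ q := by have : (0 : ℝ) ≤ m := Nat.cast_nonneg m; linarith
  have p1' : ∀ j, |dd j θ x| ≤ q * κ * (ζ x ^ (m + 2) * ζ x) := fun j => by
    refine (p1 j x).trans (le_of_eq ?_)
    rw [hq]; ring
  have p2' : ∀ i j, |dd i (dd j θ) x| ≤ q ^ 2 * κ ^ 2 * ζ x ^ (m + 2) := fun i j => by
    refine (p2 i j x).trans (le_of_eq ?_)
    rw [hq]; ring
  have hP := gsq_nonneg U x
  set B := √(gsq U x) + κ * M with hB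
  have hs := Real.sqrt_nonneg (gsq U x)
  have hB0 : 0 ≤ B := by positivity
  have hζx := h0 x
  set ρ := ζ x ^ (m + 2) with hρ
  have hρ0 : 0 ≤ ρ := by positivity
  refine ⟨5 * q ^ 2 * κ * (ζ x * B + κ * M), by positivity, ?_, ?_⟩
  · rcases le_or_gt ‖x‖ r with hx | hx
    · have hz : ∀ s : ℝ, 0 ≤ s → s ≤ 1 → ‖x + s • t • ee k‖ ≤ r + 1 := by
        intro s hs0 hs1
        have : ‖s • t • ee k‖ ≤ 1 := by
          rw [norm_smul, norm_smul, norm_ee, Real.norm_eq_abs, Real.norm_eq_abs, abs_of_pos ht,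
            abs_of_nonneg hs0]
          nlinarith
        linarith [norm_add_le x (s • t • ee k)]
      have a1 : ∀ i j, |avg (t • ee k) (dd j (U i)) x| ≤ B := by
        intro i j
        have := avg_close (c := dd j (U i) x) (τ := κ * M) (dd_cont (hU i) j) (t • ee k) x
          (fun s hs0 hs1 => hcl i j x hx k s (by rw [abs_of_nonneg hs0]; exact hs1))
        have h2 : |dd j (U i) x| ≤ √(gsq U x) := Real.abs_le_sqrt (dd_sq_le_gsq U x i j)
        have h3 := abs_add_le (avg (t • ee k) (dd j (U i)) x - dd j (U i) x) (dd j (U i) x)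
        rw [sub_add_cancel] at h3
        linarith
      have a2 : ∀ i, |avg (t • ee k) (U i) x| ≤ M := by
        intro i
        have := avg_close (c := 0) (τ := M) (hU i).continuous (t • ee k) x
          (fun s hs0 hs1 => by rw [sub_zero]; exact hUM i _ (hz s hs0 hs1))
        rwa [sub_zero] at this
      have f1 : ∀ l i j, |dd l θ x * avg (t • ee k) (dd j (U i)) x| ≤ q * κ * (ρ * ζ x) * B := by
        intro l i j
        rw [abs_mul]
        exact mul_le_mul (p1' l) (a1 i j) (abs_nonneg _) (by positivity)
      have f2 : ∀ l n i, |dd l (dd n θ) x * avg (t • ee k) (U i) x| ≤ q ^ 2 * κ ^ 2 * ρ * M := by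
        intro l n i
        rw [abs_mul]
        exact mul_le_mul (p2' l n) (a2 i) (abs_nonneg _) (by positivity)
      have f3 : |∑ l, (dd j (dd l θ) x * avg (t • ee k) (U l) x
          + dd l θ x * avg (t • ee k) (dd j (U l)) x)| ≤
          3 * (q ^ 2 * κ ^ 2 * ρ * M + q * κ * (ρ * ζ x) * B) := by
        refine (Finset.abs_sum_le_sum_abs _ _).trans ?_
        refine (Finset.sum_le_sum (fun l _ => (abs_add_le _ _).trans
          (add_le_add (f2 j l l) (f1 l l j)))).trans (le_of_eq ?_)
        simp
        ring
      have f4 : |(if i = k then (1 : ℝ) else 0) * ∑ l, (dd j (dd l θ) x * avg (t • ee k) (U l) x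
          + dd l θ x * avg (t • ee k) (dd j (U l)) x)| ≤
          3 * (q ^ 2 * κ ^ 2 * ρ * M + q * κ * (ρ * ζ x) * B) := by
        split_ifs
        · rw [one_mul]; exact f3
        · rw [zero_mul, abs_zero]; positivity
      have g1 := f1 j i k
      have g2 := f2 j k i
      have g3 := f1 k i j
      unfold restT
      refine (abs_sub _ _).trans ((add_le_add (abs_add_three _ _ _) f4).trans ?_)
      have e1 : q * κ * (ρ * ζ x) * B ≤ q ^ 2 * κ * (ρ * ζ x) * B := by
        have : q ≤ q ^ 2 := by nlinarith
        gcongr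
      have e2 : 0 ≤ q ^ 2 * κ ^ 2 * ρ * M := by positivity
      nlinarith
    · have hzz : ζ x = 0 := hr x hx.le
      have hρz : ρ = 0 := by rw [hρ, hzz]; simp
      have b1 : ∀ j, dd j θ x = 0 := fun j => by
        have := p1' j; rw [hρz] at this; simpa using this
      have b2 : ∀ i j, dd i (dd j θ) x = 0 := fun i j => by
        have := p2' i j; rw [hρz] at this; simpa using this
      unfold restT
      simp [b1, b2, hρz]
  · have hB2 : B ^ 2 ≤ 2 * gsq U x + 2 * (κ * M) ^ 2 := by
      have := Real.sq_sqrt hP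
      rw [hB]
      nlinarith [sq_nonneg (√(gsq U x) - κ * M)]
    have h2 : ζ x ^ 2 ≤ 1 := pow_le_one₀ hζx (h1 x)
    have h3 : (ζ x * B + κ * M) ^ 2 ≤ 6 * (ζ x ^ 2 * gsq U x + κ ^ 2 * M ^ 2) := by
      have : (ζ x * B + κ * M) ^ 2 ≤ 2 * (ζ x ^ 2 * B ^ 2) + 2 * (κ * M) ^ 2 := by
        nlinarith [sq_nonneg (ζ x * B - κ * M)]
      have h5 : ζ x ^ 2 * B ^ 2 ≤ ζ x ^ 2 * (2 * gsq U x + 2 * (κ * M) ^ 2) :=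
        mul_le_mul_of_nonneg_left hB2 (sq_nonneg _)
      have h6 : ζ x ^ 2 * (κ * M) ^ 2 ≤ 1 * (κ * M) ^ 2 :=
        mul_le_mul_of_nonneg_right h2 (sq_nonneg _)
      have h7 : 0 ≤ ζ x ^ 2 * gsq U x := by positivity
      nlinarith
    calc (5 * q ^ 2 * κ * (ζ x * B + κ * M)) ^ 2
        = 25 * q ^ 4 * κ ^ 2 * (ζ x * B + κ * M) ^ 2 := by ring
      _ ≤ 25 * q ^ 4 * κ ^ 2 * (6 * (ζ x ^ 2 * gsq U x + κ ^ 2 * M ^ 2)) :=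
        mul_le_mul_of_nonneg_left h3 (by positivity)
      _ = _ := by ring

lemma eps_cont {U : Fin 3 → E3 → ℝ} (hU : ∀ i, ContDiff ℝ 1 (U i)) (i j : Fin 3) :
    Continuous fun x => eps U x i j :=
  ((dd_cont (hU i) j).add (dd_cont (hU j) i)).div_const 2

lemma gsq_cont {U : Fin 3 → E3 → ℝ} (hU : ∀ i, ContDiff ℝ 1 (U i)) : Continuous (gsq U) :=
  continuous_finsetSum _ fun i _ => continuous_finsetSum _ fun j _ => (dd_cont (hU i) j).pow 2

lemma cacc_est {U : Fin 3 → E3 → ℝ} (hU : ∀ i, ContDiff ℝ 1 (U i)) (hdiv : ∀ x, ∑ i, dd i (U i) x = 0)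
    {S : E3 → Matrix (Fin 3) (Fin 3) ℝ} (hS : ∀ i j, Continuous fun x => S x i j)
    (hsym : ∀ x i j, S x i j = S x j i) (hW : WeakC1 S) {c₂ : ℝ} (hc₂ : 0 < c₂)
    (hup : ∀ x y, frob (S x - S y) (S x - S y) ≤ c₂ * frob (S x - S y) (eps U x - eps U y))
    {ζ : E3 → ℝ} (hζ : ContDiff ℝ (⊤ : ℕ∞) ζ) (h0 : ∀ x, 0 ≤ ζ x) (h1 : ∀ x, ζ x ≤ 1)
    {κ M r t : ℝ} (hr : ∀ x, r ≤ ‖x‖ → ζ x = 0) (hκ : 0 < κ) (hM : 0 < M)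
    (hd : ∀ j x, |dd j ζ x| ≤ κ) (hdd : ∀ i j x, |dd i (dd j ζ) x| ≤ κ ^ 2) {m : ℕ} (hm : 1 ≤ m)
    (hUM : ∀ i x, ‖x‖ ≤ r + 1 → |U i x| ≤ M) (ht : 0 < t) (ht1 : t ≤ 1)
    (hcl : ∀ i j x, ‖x‖ ≤ r → ∀ k, ∀ s : ℝ, |s| ≤ 1 →
      |dd j (U i) (x + s • t • ee k) - dd j (U i) x| ≤ κ * M) (k : Fin 3) :
    ∫ x, ζ x ^ (m + 4) * (frob (S (x + t • ee k) - S x) (eps U (x + t • ee k) - eps U x) / t ^ 2)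
      ≤ 1350 * c₂ * (m + 4) ^ 4 * κ ^ 2 * ((∫ x, ζ x ^ (m + 2) * gsq U x) + κ ^ 2 * M ^ 2 * ∫ x, ζ x) := by
  have hζ2 : ContDiff ℝ 2 fun y => ζ y ^ (m + 4) := (contDiff_infty.1 hζ 2).pow _
  have hθr : ∀ x, r ≤ ‖x‖ → ζ x ^ (m + 4) = 0 := fun x hx => by rw [hr x hx]; simp
  obtain ⟨c1, c2, c3⟩ := cacc_id hU hdiv hS hW hζ2 hθr k ht
  set z := t • ee k with hz
  have hζc : Continuous ζ := hζ.continuous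
  have hsh : ∀ {f : E3 → ℝ}, Continuous f → Continuous fun x => f (x + z) := fun hf => by fun_prop
  set I : E3 → ℝ := fun x => ∑ i, ∑ j, (S (x + z) i j - S x i j) *
      (ζ x ^ (m + 4) * ((dd j (U i) (x + z) - dd j (U i) x) / t)
        + restT (fun y => ζ y ^ (m + 4)) U k t i j x) with hI
  have hIc : Continuous I := by
    refine continuous_finsetSum _ fun i _ => continuous_finsetSum _ fun j _ => ?_
    exact ((hsh (hS i j)).sub (hS i j)).mul (((hζc.pow _).mul
      (((hsh (dd_cont (hU i) j)).sub (dd_cont (hU i) j)).div_const t)).add (c1 i j))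
  have hIr : ∀ x, r + 2 ≤ ‖x‖ → I x = 0 := fun x hx =>
    Finset.sum_eq_zero fun i _ => Finset.sum_eq_zero fun j _ => by
      rw [hθr x (by linarith), c2 i j x hx]; ring
  set E : E3 → ℝ := fun x => frob (S (x + z) - S x) (eps U (x + z) - eps U x) / t ^ 2 with hE
  have hEc : Continuous E := by
    refine Continuous.div_const (cont_frob (fun i j => ?_) (fun i j => ?_)) _
    · exact (hsh (hS i j)).sub (hS i j)
    · exact (hsh (eps_cont hU i j)).sub (eps_cont hU i j)
  have point : ∀ x, ζ x ^ (m + 4) * E x ≤ 2 / t * I x + 1350 * c₂ * (m + 4) ^ 4 * κ ^ 2 *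
      (ζ x ^ (m + 2) * gsq U x + κ ^ 2 * M ^ 2 * ζ x) := by
    intro x
    have hζx := h0 x
    set G : Matrix (Fin 3) (Fin 3) ℝ := S (x + z) - S x with hG
    have hGs : ∀ i j, G i j = G j i := fun i j => by
      simp only [hG, Matrix.sub_apply]; rw [hsym, hsym x]
    have hGE : frob G G / t ^ 2 ≤ c₂ * E x := by
      rw [hE]; simp only
      rw [mul_div_assoc']
      exact div_le_div_of_nonneg_right (hup _ _) (by positivity)
    have hdec : I x / t = ζ x ^ (m + 4) * E x
        + ∑ i, ∑ j, G i j / t * restT (fun y => ζ y ^ (m + 4)) U k t i j x := by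
      have e1 := frob_eps_sym hGs (fun i j => dd j (U i) (x + z) - dd j (U i) x)
      have e2 : (fun i j => ((dd j (U i) (x + z) - dd j (U i) x)
          + (dd i (U j) (x + z) - dd i (U j) x)) / 2) = eps U (x + z) - eps U x := by
        ext i j
        simp only [eps, Matrix.sub_apply]
        ring
      rw [e2] at e1
      have e3 : ζ x ^ (m + 4) * E x = ∑ i, ∑ j, G i j / t *
          (ζ x ^ (m + 4) * ((dd j (U i) (x + z) - dd j (U i) x) / t)) := by
        rw [hE]; simp only
        rw [← e1, Finset.sum_div, Finset.mul_sum]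
        refine Finset.sum_congr rfl fun i _ => ?_
        rw [Finset.sum_div, Finset.mul_sum]
        refine Finset.sum_congr rfl fun j _ => ?_
        field_simp
      rw [e3, ← Finset.sum_add_distrib, hI, Finset.sum_div]
      refine Finset.sum_congr rfl fun i _ => ?_
      rw [← Finset.sum_add_distrib, Finset.sum_div]
      refine Finset.sum_congr rfl fun j _ => ?_
      rw [hG, Matrix.sub_apply]
      ring
    set Y : ℝ := 150 * (m + 4) ^ 4 * κ ^ 2 * (ζ x ^ 2 * gsq U x + κ ^ 2 * M ^ 2) with hY
    have young : ∀ i j, -(G i j / t * restT (fun y => ζ y ^ (m + 4)) U k t i j x) ≤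
        ζ x ^ (m + 4) / (2 * c₂) * (G i j * G i j / t ^ 2) + c₂ / 2 * ζ x ^ m * Y := by
      intro i j
      obtain ⟨b, hb0, hb1, hb2⟩ := restT_bound hU hζ h0 h1 hr hκ hM hd hdd m hUM ht ht1 hcl k i j x
      set g := G i j / t with hg
      have hgg : G i j * G i j / t ^ 2 = g ^ 2 := by rw [hg]; ring
      rw [hgg]
      have s1 : -(g * restT (fun y => ζ y ^ (m + 4)) U k t i j x) ≤ |g| * (ζ x ^ (m + 2) * b) := by
        refine (neg_le_abs _).trans ?_
        rw [abs_mul]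
        exact mul_le_mul_of_nonneg_left hb1 (abs_nonneg _)
      have s2 : ζ x ^ 2 * |g| * b ≤ ζ x ^ 4 * g ^ 2 / (2 * c₂) + c₂ / 2 * b ^ 2 := by
        have : ζ x ^ 4 * g ^ 2 / (2 * c₂) + c₂ / 2 * b ^ 2 - ζ x ^ 2 * |g| * b
            = (ζ x ^ 2 * |g| - c₂ * b) ^ 2 / (2 * c₂) := by
          rw [← sq_abs g]; field_simp; ring
        have : 0 ≤ (ζ x ^ 2 * |g| - c₂ * b) ^ 2 / (2 * c₂) := by positivity
        linarith
      have s3 : c₂ / 2 * b ^ 2 ≤ c₂ / 2 * Y := mul_le_mul_of_nonneg_left hb2 (by positivity)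
      calc _ ≤ |g| * (ζ x ^ (m + 2) * b) := s1
        _ = ζ x ^ m * (ζ x ^ 2 * |g| * b) := by ring
        _ ≤ ζ x ^ m * (ζ x ^ 4 * g ^ 2 / (2 * c₂) + c₂ / 2 * Y) :=
          mul_le_mul_of_nonneg_left (by linarith) (by positivity)
        _ = _ := by ring
    have ysum : -(∑ i, ∑ j, G i j / t * restT (fun y => ζ y ^ (m + 4)) U k t i j x) ≤
        ζ x ^ (m + 4) / (2 * c₂) * (frob G G / t ^ 2) + 9 * (c₂ / 2 * ζ x ^ m * Y) := by
      rw [← Finset.sum_neg_distrib]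
      simp only [← Finset.sum_neg_distrib]
      refine (Finset.sum_le_sum fun i _ => Finset.sum_le_sum fun j _ => young i j).trans (le_of_eq ?_)
      simp only [Finset.sum_add_distrib, ← Finset.mul_sum, ← Finset.sum_div]
      simp only [frob, Finset.sum_const, Finset.card_univ, Fintype.card_fin, nsmul_eq_mul]
      push_cast
      ring
    have y2 : ζ x ^ (m + 4) / (2 * c₂) * (frob G G / t ^ 2) ≤ ζ x ^ (m + 4) * E x / 2 := by
      calc _ ≤ ζ x ^ (m + 4) / (2 * c₂) * (c₂ * E x) :=
            mul_le_mul_of_nonneg_left hGE (by positivity)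
        _ = _ := by field_simp
    have y3 : ζ x ^ m * Y ≤ 150 * (m + 4) ^ 4 * κ ^ 2 *
        (ζ x ^ (m + 2) * gsq U x + κ ^ 2 * M ^ 2 * ζ x) := by
      have : ζ x ^ m ≤ ζ x := pow_le_of_le_one hζx (h1 x) (by omega)
      calc ζ x ^ m * Y = 150 * (m + 4) ^ 4 * κ ^ 2 *
          (ζ x ^ (m + 2) * gsq U x + κ ^ 2 * M ^ 2 * ζ x ^ m) := by rw [hY]; ring
        _ ≤ _ := by gcongr
    have y4 : 2 / t * I x = 2 * (I x / t) := by ring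
    rw [y4, hdec]
    nlinarith
  have i1 : Integrable fun x => ζ x ^ (m + 4) * E x :=
    int_cs ((hζc.pow _).mul hEc) (r := r) fun x hx => by simp only [hθr x hx, zero_mul]
  have i2 : Integrable I := int_cs hIc hIr
  have i3 : Integrable fun x => ζ x ^ (m + 2) * gsq U x :=
    int_cs ((hζc.pow _).mul (gsq_cont hU)) (r := r) fun x hx => by simp [hr x hx]
  have i4 : Integrable ζ := int_cs hζc hr
  have i5 : Integrable fun x => ζ x ^ (m + 2) * gsq U x + κ ^ 2 * M ^ 2 * ζ x :=
    i3.add (i4.const_mul (κ ^ 2 * M ^ 2))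
  have := integral_mono i1 ((i2.const_mul (2 / t)).add
    (i5.const_mul (1350 * c₂ * (m + 4) ^ 4 * κ ^ 2))) point
  refine this.trans (le_of_eq ?_)
  simp only [Pi.add_apply]
  rw [integral_add (i2.const_mul _) (i5.const_mul _), integral_const_mul, integral_const_mul, c3,
    integral_add i3 (i4.const_mul _), integral_const_mul]
  ring

end

section
open MeasureTheory Real Filter

lemma korn_id {U : Fin 3 → E3 → ℝ} (hU : ∀ i, ContDiff ℝ 1 (U i)) (hdiv : ∀ x, ∑ i, dd i (U i) x = 0)
    {a : E3 → ℝ} (ha : ContDiff ℝ 1 a) {r : ℝ} (hr : ∀ x, r ≤ ‖x‖ → a x = 0) :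
    ∫ x, a x * gsq U x = 2 * (∑ i, ∑ j, ∫ x, a x * eps U x i j * dd j (U i) x)
      + ∑ i, ∑ j, ∫ x, dd i a x * dd j (U i) x * U j x := by
  have hac := ha.continuous
  have hz : ∀ i x, r + 1 ≤ ‖x‖ → dd i a x = 0 := fun i x hx => dd_zero_of hr i x (by linarith)
  have i1 : ∀ i j, Integrable fun x => a x * eps U x i j * dd j (U i) x := fun i j =>
    int_cs ((hac.mul (eps_cont hU i j)).mul (dd_cont (hU i) j)) (r := r) fun x hx => by simp [hr x hx]
  have i2 : ∀ i j, Integrable fun x => dd i a x * dd j (U i) x * U j x := fun i j =>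
    int_cs (((dd_cont ha i).mul (dd_cont (hU i) j)).mul (hU j).continuous) (r := r + 1)
      fun x hx => by simp [hz i x hx]
  have i3 : ∀ i j, Integrable fun x => a x * (dd i (U j) x * dd j (U i) x) := fun i j =>
    int_cs (hac.mul ((dd_cont (hU j) i).mul (dd_cont (hU i) j))) (r := r) fun x hx => by simp [hr x hx]
  have i4 : ∀ i j, Integrable fun x => dd j (fun y => a y * U j y) x * dd i (U i) x := fun i j =>
    int_cs ((dd_cont (ha.mul (hU j)) j).mul (dd_cont (hU i) i)) (r := r + 1) fun x hx => by
      have := dd_zero_of (f := fun y => a y * U j y) (r := r) (fun x hx => by simp [hr x hx]) j x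
        (by linarith)
      change dd j (fun y => a y * U j y) x * _ = 0
      rw [this, zero_mul]
  have ex : ∀ i j, (∫ x, a x * (dd i (U j) x * dd j (U i) x)) + ∫ x, dd i a x * dd j (U i) x * U j x
      = ∫ x, dd j (fun y => a y * U j y) x * dd i (U i) x := by
    intro i j
    have := exchange (ha.mul (hU j)) (hU i) (r := r) (fun x hx => by simp [hr x hx]) i j
    rw [← integral_add (i3 i j) (i2 i j)]
    refine Eq.trans ?_ this
    congr 1
    funext x
    have h2 := dd_mul (ha.differentiable (by norm_num)) ((hU j).differentiable (by norm_num)) i x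
    change _ = dd i (fun y => a y * U j y) x * _
    rw [h2]
    ring
  have s0 : ∑ j, ∑ i, ∫ x, dd j (fun y => a y * U j y) x * dd i (U i) x = 0 := by
    refine Finset.sum_eq_zero fun j _ => ?_
    rw [← integral_finsetSum _ (fun i _ => i4 i j)]
    simp only [← Finset.mul_sum, hdiv, mul_zero, integral_zero]
  have s1 : (∑ i, ∑ j, ∫ x, a x * (dd i (U j) x * dd j (U i) x))
      + ∑ i, ∑ j, ∫ x, dd i a x * dd j (U i) x * U j x = 0 := by
    rw [← s0, Finset.sum_comm (f := fun j i => ∫ x, dd j (fun y => a y * U j y) x * dd i (U i) x),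
      ← Finset.sum_add_distrib]
    refine Finset.sum_congr rfl fun i _ => ?_
    rw [← Finset.sum_add_distrib]
    exact Finset.sum_congr rfl fun j _ => ex i j
  have s2 : ∫ x, a x * gsq U x = 2 * (∑ i, ∑ j, ∫ x, a x * eps U x i j * dd j (U i) x)
      - ∑ i, ∑ j, ∫ x, a x * (dd i (U j) x * dd j (U i) x) := by
    have e1 : ∑ i, ∑ j, ∫ x, a x * eps U x i j * dd j (U i) x
        = ∫ x, ∑ i, ∑ j, a x * eps U x i j * dd j (U i) x := by
      rw [integral_finsetSum _ fun i _ => integrable_finsetSum _ fun j _ => i1 i j]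
      exact Finset.sum_congr rfl fun i _ => (integral_finsetSum _ fun j _ => i1 i j).symm
    have e2 : ∑ i, ∑ j, ∫ x, a x * (dd i (U j) x * dd j (U i) x)
        = ∫ x, ∑ i, ∑ j, a x * (dd i (U j) x * dd j (U i) x) := by
      rw [integral_finsetSum _ fun i _ => integrable_finsetSum _ fun j _ => i3 i j]
      exact Finset.sum_congr rfl fun i _ => (integral_finsetSum _ fun j _ => i3 i j).symm
    rw [e1, e2, ← integral_const_mul, ← integral_sub]
    · congr 1
      funext x
      unfold gsq eps
      rw [Finset.mul_sum, Finset.mul_sum, ← Finset.sum_sub_distrib]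
      refine Finset.sum_congr rfl fun i _ => ?_
      rw [Finset.mul_sum, Finset.mul_sum, ← Finset.sum_sub_distrib]
      refine Finset.sum_congr rfl fun j _ => ?_
      ring
    · exact (integrable_finsetSum _ fun i _ => integrable_finsetSum _ fun j _ => i1 i j).const_mul 2
    · exact integrable_finsetSum _ fun i _ => integrable_finsetSum _ fun j _ => i3 i j
  linarith

lemma ball_bound {f : E3 → ℝ} (hf : Continuous f) (r : ℝ) : ∃ B, 0 ≤ B ∧ ∀ x, ‖x‖ ≤ r → |f x| ≤ B := by
  obtain ⟨B, hB⟩ := (isCompact_closedBall (0 : E3) r).exists_bound_of_continuousOn hf.continuousOn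
  exact ⟨|B|, abs_nonneg _, fun x hx => (hB x (by simpa using hx)).trans (le_abs_self _)⟩

lemma interp_limit {a e g : E3 → ℝ} (ha : ContDiff ℝ 1 a) (he : Continuous e) (hg : ContDiff ℝ 1 g)
    {r : ℝ} (hr : ∀ x, r ≤ ‖x‖ → a x = 0) (j : Fin 3) {η : ℝ} (hη : 0 < η) :
    ∀ᶠ t in nhdsWithin (0 : ℝ) (Set.Ioi 0),
      |(∫ x, a x * e x * dd j g x) + (∫ x, a x * ((e (x + t • ee j) - e x) / t) * g x)
        + ∫ x, dd j a x * e x * g x| ≤ η := by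
  have hac := ha.continuous
  have hgc := hg.continuous
  obtain ⟨B1, hB10, hB1⟩ := ball_bound (hac.mul he) (r + 1)
  obtain ⟨B2, hB20, hB2⟩ := ball_bound hgc (r + 1)
  obtain ⟨B3, hB30, hB3⟩ := ball_bound he (r + 2)
  obtain ⟨B4, hB40, hB4⟩ := ball_bound (dd_cont ha j) (r + 1)
  set V := volume.real (Metric.ball (0 : E3) (r + 1)) with hV
  have hV0 : 0 ≤ V := measureReal_nonneg
  set K := (B1 + (B4 + B3) * B2) * V with hK
  have hK0 : 0 ≤ K := by positivity
  set τ := η / (K + 1) with hτ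
  have hτ0 : 0 < τ := by positivity
  filter_upwards [diffq_ev hg (r + 1) hτ0 j, diffq_ev ha (r + 1) hτ0 j, unif_ev he (r + 1) hτ0,
    Ioo_mem_nhdsGT one_pos] with t t1 t2 t3 ht
  have ht0 : 0 < t := ht.1
  set z := t • ee j with hz
  have hzn : ‖z‖ ≤ 1 := by
    rw [hz, norm_smul, norm_ee, Real.norm_eq_abs, abs_of_pos ht0]; linarith [ht.2]
  have hzr : ∀ x, r + 1 ≤ ‖x‖ → a (x + z) = 0 := fun x hx => hr _ (by
    have := norm_sub_le (x + z) z
    rw [add_sub_cancel_right] at this; linarith)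
  have hz1 : ∀ x, r + 1 ≤ ‖x‖ → a x = 0 := fun x hx => hr _ (by linarith)
  have hdz : ∀ x, r + 1 ≤ ‖x‖ → dd j a x = 0 := fun x hx => dd_zero_of hr j x (by linarith)
  have cda := dd_cont ha j
  have cdg := dd_cont hg j
  have j1 : Integrable fun x => a x * e x * dd j g x :=
    int_cs (by fun_prop) (r := r) fun x hx => by simp [hr x hx]
  have j2 : Integrable fun x => a x * ((e (x + z) - e x) / t) * g x :=
    int_cs (by fun_prop) (r := r) fun x hx => by simp [hr x hx]
  have j3 : Integrable fun x => dd j a x * e x * g x :=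
    int_cs (by fun_prop) (r := r + 1) fun x hx => by simp [hdz x hx]
  have j4 : Integrable fun x => a (x + z) * e (x + z) * g x :=
    int_cs (by fun_prop) (r := r + 1) fun x hx => by simp [hzr x hx]
  have j5 : Integrable fun x => a x * e x * g (x - z) :=
    int_cs (by fun_prop) (r := r) fun x hx => by simp [hr x hx]
  have tr : ∫ x, a (x + z) * e (x + z) * g x = ∫ x, a x * e x * g (x - z) := by
    rw [← integral_add_right_eq_self (fun x => a x * e x * g (x - z)) z]
    simp only [add_sub_cancel_right]
  set T : E3 → ℝ := fun x => a x * e x * dd j g x + a x * ((e (x + z) - e x) / t) * g x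
      + dd j a x * e x * g x
      - t⁻¹ * (a (x + z) * e (x + z) * g x - a x * e x * g (x - z)) with hT
  have hTi : Integrable T := ((j1.add j2).add j3).sub ((j4.sub j5).const_mul t⁻¹)
  have hTeq : ∫ x, T x = (∫ x, a x * e x * dd j g x) + (∫ x, a x * ((e (x + z) - e x) / t) * g x)
        + ∫ x, dd j a x * e x * g x := by
    have j12 : Integrable fun x => a x * e x * dd j g x + a x * ((e (x + z) - e x) / t) * g x := j1.add j2
    have j123 : Integrable fun x => a x * e x * dd j g x + a x * ((e (x + z) - e x) / t) * g x
      + dd j a x * e x * g x := j12.add j3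
    have j45 : Integrable fun x => t⁻¹ * (a (x + z) * e (x + z) * g x - a x * e x * g (x - z)) :=
      (j4.sub j5).const_mul t⁻¹
    rw [hT, integral_sub j123 j45, integral_add j12 j3, integral_add j1 j2, integral_const_mul,
      integral_sub j4 j5, tr]
    ring
  rw [← hTeq]
  have hb := int_diff (f := T) (g := fun _ => 0) (r := r + 1) (τ := τ * (B1 + (B4 + B3) * B2)) hTi
    (integrable_zero _ _ _) (fun x hx => by
      simp only [hT, hz1 x hx, hzr x hx, hdz x hx]; ring) (fun _ _ => rfl) (by
    intro x hx
    rw [sub_zero]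
    have hxr := hx.le
    have e1 : T x = (a x * e x) * (dd j g x - (g x - g (x - z)) / t)
        + (dd j a x * (e x - e (x + z)) - ((a (x + z) - a x) / t - dd j a x) * e (x + z)) * g x := by
      rw [hT]; simp only
      field_simp
      ring
    rw [e1]
    have u1 : |(a x * e x) * (dd j g x - (g x - g (x - z)) / t)| ≤ B1 * τ := by
      rw [abs_mul]
      refine mul_le_mul (hB1 x hxr) ?_ (abs_nonneg _) hB10
      rw [abs_sub_comm]; exact (t1 x hxr).2
    have u2 : |dd j a x * (e x - e (x + z))| ≤ B4 * τ := by
      rw [abs_mul]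
      refine mul_le_mul (hB4 x hxr) ?_ (abs_nonneg _) hB40
      rw [abs_sub_comm]
      have := t3 x hxr j 1 (by simp)
      rwa [one_smul] at this
    have u3 : |((a (x + z) - a x) / t - dd j a x) * e (x + z)| ≤ τ * B3 := by
      rw [abs_mul]
      refine mul_le_mul (t2 x hxr).1 (hB3 _ ?_) (abs_nonneg _) hτ0.le
      linarith [norm_add_le x z]
    have u4 : |(dd j a x * (e x - e (x + z)) - ((a (x + z) - a x) / t - dd j a x) * e (x + z)) * g x|
        ≤ (B4 * τ + τ * B3) * B2 := by
      rw [abs_mul]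
      exact mul_le_mul ((abs_sub _ _).trans (add_le_add u2 u3)) (hB2 x hxr) (abs_nonneg _) (by positivity)
    refine (abs_add_le _ _).trans ((add_le_add u1 u4).trans (le_of_eq ?_))
    ring)
  simp only [integral_zero, sub_zero] at hb
  refine hb.trans ?_
  rw [mul_assoc, ← hK, hτ, div_mul_eq_mul_div, div_le_iff₀ (by positivity)]
  nlinarith

lemma weight_bound {μ : ℝ} (hμ₂ : μ < 2) {N : ℕ} (hN : μ ≤ N * (2 - μ)) {s w : ℝ} (hs : 0 ≤ s)
    (hw : 1 ≤ w) : s ^ (2 * N + 1) * w ^ μ ≤ s + s ^ (2 * N + 1 + 2) * w ^ 2 := by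
  have hw0 : 0 < w := by linarith
  rcases le_or_gt (w ^ μ) (s ^ 2 * w ^ 2) with h | h
  · have : s ^ (2 * N + 1) * w ^ μ ≤ s ^ (2 * N + 1) * (s ^ 2 * w ^ 2) :=
      mul_le_mul_of_nonneg_left h (by positivity)
    calc _ ≤ s ^ (2 * N + 1) * (s ^ 2 * w ^ 2) := this
      _ = s ^ (2 * N + 1 + 2) * w ^ 2 := by ring
      _ ≤ _ := by linarith
  · have h1 : s ^ 2 * w ^ (2 - μ) ≤ 1 := by
      rw [Real.rpow_sub hw0, Real.rpow_two, mul_div_assoc', div_le_one (by positivity)]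
      exact h.le
    have h2 : (s ^ 2 * w ^ (2 - μ)) ^ N ≤ 1 := pow_le_one₀ (by positivity) h1
    rw [mul_pow, ← pow_mul, ← Real.rpow_natCast (w ^ (2 - μ)) N, ← Real.rpow_mul hw0.le] at h2
    have h3 : w ^ μ ≤ w ^ ((2 - μ) * N) := Real.rpow_le_rpow_of_exponent_le hw (by linarith)
    have h4 : s ^ (2 * N) * w ^ μ ≤ 1 :=
      (mul_le_mul_of_nonneg_left h3 (by positivity)).trans h2
    have h5 : s ^ (2 * N + 1) * w ^ μ = s * (s ^ (2 * N) * w ^ μ) := by ring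
    rw [h5]
    have : s * (s ^ (2 * N) * w ^ μ) ≤ s * 1 := mul_le_mul_of_nonneg_left h4 hs
    have h6 : 0 ≤ s ^ (2 * N + 1 + 2) * w ^ 2 := by positivity
    linarith

lemma eps_sq_le (U : Fin 3 → E3 → ℝ) (x : E3) : frob (eps U x) (eps U x) ≤ gsq U x := by
  unfold frob eps gsq
  have : ∀ i j : Fin 3, (dd j (U i) x + dd i (U j) x) / 2 * ((dd j (U i) x + dd i (U j) x) / 2)
      ≤ dd j (U i) x ^ 2 / 2 + dd i (U j) x ^ 2 / 2 := by
    intro i j; nlinarith [sq_nonneg (dd j (U i) x - dd i (U j) x)]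
  refine (Finset.sum_le_sum fun i _ => Finset.sum_le_sum fun j _ => this i j).trans (le_of_eq ?_)
  simp only [Finset.sum_add_distrib]
  rw [Finset.sum_comm (f := fun i j => dd i (U j) x ^ 2 / 2), ← Finset.sum_add_distrib]
  refine Finset.sum_congr rfl fun i _ => ?_
  rw [← Finset.sum_add_distrib]
  exact Finset.sum_congr rfl fun i _ => by ring

lemma entry_sq_le (A : Matrix (Fin 3) (Fin 3) ℝ) (i j : Fin 3) : A i j ^ 2 ≤ frob A A := by
  rw [sq]
  exact le_sum2 (fun i j => A i j * A i j) (fun _ _ => mul_self_nonneg _) i j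

/-- terms with the gradient of the cutoff -/
lemma cut_term {U : Fin 3 → E3 → ℝ} (hU : ∀ i, ContDiff ℝ 1 (U i))
    {ζ : E3 → ℝ} (hζ : ContDiff ℝ (⊤ : ℕ∞) ζ) (h0 : ∀ x, 0 ≤ ζ x) (h1 : ∀ x, ζ x ≤ 1)
    {κ M r : ℝ} (hr : ∀ x, r ≤ ‖x‖ → ζ x = 0) (hκ : 0 < κ) (hM : 0 < M)
    (hd : ∀ j x, |dd j ζ x| ≤ κ) (hdd : ∀ i j x, |dd i (dd j ζ) x| ≤ κ ^ 2) {m : ℕ} (hm : 1 ≤ m)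
    (hUM : ∀ i x, ‖x‖ ≤ r + 1 → |U i x| ≤ M) {f : E3 → ℝ} (hf : Continuous f)
    (hfP : ∀ x, f x ^ 2 ≤ gsq U x) (i j : Fin 3) :
    |∫ x, dd j (fun y => ζ y ^ (m + 2)) x * f x * U i x|
      ≤ (∫ x, ζ x ^ (m + 2) * gsq U x) / 144 + 36 * (m + 2) ^ 2 * κ ^ 2 * M ^ 2 * ∫ x, ζ x := by
  have p1 := (cutoff_pow hζ h0 h1 hd hdd (m + 1)).1
  have hζc : Continuous ζ := hζ.continuous
  have i3 : Integrable fun x => ζ x ^ (m + 2) * gsq U x :=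
    int_cs ((hζc.pow _).mul (gsq_cont hU)) (r := r) fun x hx => by simp [hr x hx]
  have i4 : Integrable ζ := int_cs hζc hr
  have hnorm_int := norm_integral_le_of_norm_le (f := fun x => dd j (fun y => ζ y ^ (m + 2)) x * f x * U i x)
    (g := fun x => ζ x ^ (m + 2) * gsq U x / 144 + 36 * (m + 2) ^ 2 * κ ^ 2 * M ^ 2 * ζ x)
    ((i3.div_const 144).add (i4.const_mul (36 * (m + 2) ^ 2 * κ ^ 2 * M ^ 2)))
    (Eventually.of_forall fun x => by
      have hζx := h0 x
      have hP := gsq_nonneg U x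
      rw [Real.norm_eq_abs, abs_mul, abs_mul]
      have q1 : |dd j (fun y => ζ y ^ (m + 2)) x| ≤ (m + 2) * κ * ζ x ^ (m + 1) := by
        refine (p1 j x).trans (le_of_eq ?_)
        push_cast; ring
      rcases le_or_gt ‖x‖ r with hx | hx
      · have q2 := hUM i x (by linarith)
        have q3 : |dd j (fun y => ζ y ^ (m + 2)) x| * |f x| * |U i x|
            ≤ (m + 2) * κ * ζ x ^ (m + 1) * |f x| * M := by gcongr
        refine q3.trans ?_
        have q4 : ζ x ^ m ≤ ζ x := pow_le_of_le_one hζx (h1 x) (by omega)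
        have q5 : ζ x * |f x| * ((m + 2) * κ * M) ≤ (ζ x * |f x|) ^ 2 / 144
            + 36 * ((m + 2) * κ * M) ^ 2 := by
          nlinarith [sq_nonneg (ζ x * |f x| - 72 * ((m + 2) * κ * M))]
        have q6 : |f x| ^ 2 ≤ gsq U x := by rw [sq_abs]; exact hfP x
        calc (m + 2) * κ * ζ x ^ (m + 1) * |f x| * M
            = ζ x ^ m * (ζ x * |f x| * ((m + 2) * κ * M)) := by ring
          _ ≤ ζ x ^ m * ((ζ x * |f x|) ^ 2 / 144 + 36 * ((m + 2) * κ * M) ^ 2) := by gcongr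
          _ = ζ x ^ (m + 2) * |f x| ^ 2 / 144 + 36 * ((m + 2) * κ * M) ^ 2 * ζ x ^ m := by ring
          _ ≤ ζ x ^ (m + 2) * gsq U x / 144 + 36 * ((m + 2) * κ * M) ^ 2 * ζ x := by gcongr
          _ = _ := by ring
      · rw [hr x hx.le] at q1 ⊢
        simp at q1
        simp [q1])
  rw [integral_add (i3.div_const 144) (i4.const_mul _), integral_div, integral_const_mul] at hnorm_int
  exact hnorm_int

end

section
open MeasureTheory Real Filter

/-- weight -/
noncomputable def wgt (μ : ℝ) (U : Fin 3 → E3 → ℝ) (x : E3) : ℝ := (1 + fnorm (eps U x)) ^ (-μ)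

lemma wgt_pos (μ : ℝ) (U : Fin 3 → E3 → ℝ) (x : E3) : 0 < wgt μ U x :=
  Real.rpow_pos_of_pos (by have := fnorm_nonneg (eps U x); linarith) _

lemma wgt_cont {U : Fin 3 → E3 → ℝ} (hU : ∀ i, ContDiff ℝ 1 (U i)) (μ : ℝ) : Continuous (wgt μ U) := by
  refine Continuous.rpow_const (continuous_const.add (cont_fnorm (eps_cont hU))) fun x => Or.inl ?_
  have := fnorm_nonneg (eps U x)
  positivity

/-- weighted squared difference quotient -/
noncomputable def YY (μ : ℝ) (U : Fin 3 → E3 → ℝ) (ζ : E3 → ℝ) (m : ℕ) (k : Fin 3) (t : ℝ) (x : E3) : ℝ :=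
  ζ x ^ (m + 4) * (wgt μ U x *
    (frob (eps U (x + t • ee k) - eps U x) (eps U (x + t • ee k) - eps U x) / t ^ 2))

lemma YY_cont {U : Fin 3 → E3 → ℝ} (hU : ∀ i, ContDiff ℝ 1 (U i)) (μ : ℝ) {ζ : E3 → ℝ}
    (hζ : Continuous ζ) (m : ℕ) (k : Fin 3) (t : ℝ) : Continuous (YY μ U ζ m k t) := by
  have hsh : ∀ i j, Continuous fun x => (eps U (x + t • ee k) - eps U x) i j := fun i j =>
    ((eps_cont hU i j).comp (by fun_prop : Continuous fun x : E3 => x + t • ee k)).sub (eps_cont hU i j)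
  exact (hζ.pow _).mul ((wgt_cont hU μ).mul ((cont_frob hsh hsh).div_const _))

lemma Y_est {U : Fin 3 → E3 → ℝ} (hU : ∀ i, ContDiff ℝ 1 (U i)) (hdiv : ∀ x, ∑ i, dd i (U i) x = 0)
    {S : E3 → Matrix (Fin 3) (Fin 3) ℝ} (hS : ∀ i j, Continuous fun x => S x i j)
    (hsym : ∀ x i j, S x i j = S x j i) (hW : WeakC1 S) {c₁ c₂ μ : ℝ} (hc₁ : 0 < c₁) (hc₂ : 0 < c₂)
    (hμ₁ : 1 < μ) (hμ₂ : μ < 2)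
    (hlow : ∀ x y, c₁ * (1 + fnorm (eps U x) + fnorm (eps U y)) ^ (-μ)
      * frob (eps U x - eps U y) (eps U x - eps U y) ≤ frob (S x - S y) (eps U x - eps U y))
    (hup : ∀ x y, frob (S x - S y) (S x - S y) ≤ c₂ * frob (S x - S y) (eps U x - eps U y))
    {ζ : E3 → ℝ} (hζ : ContDiff ℝ (⊤ : ℕ∞) ζ) (h0 : ∀ x, 0 ≤ ζ x) (h1 : ∀ x, ζ x ≤ 1)
    {κ M r t : ℝ} (hr : ∀ x, r ≤ ‖x‖ → ζ x = 0) (hκ : 0 < κ) (hM : 0 < M)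
    (hd : ∀ j x, |dd j ζ x| ≤ κ) (hdd : ∀ i j x, |dd i (dd j ζ) x| ≤ κ ^ 2) {m : ℕ} (hm : 1 ≤ m)
    (hUM : ∀ i x, ‖x‖ ≤ r + 1 → |U i x| ≤ M) (ht : 0 < t) (ht1 : t ≤ 1)
    (hcl : ∀ i j x, ‖x‖ ≤ r → ∀ k, ∀ s : ℝ, |s| ≤ 1 →
      |dd j (U i) (x + s • t • ee k) - dd j (U i) x| ≤ κ * M) 
    (hfn : ∀ x, ‖x‖ ≤ r → ∀ k, |fnorm (eps U (x + t • ee k)) - fnorm (eps U x)| ≤ 1) (k : Fin 3) :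
    ∫ x, YY μ U ζ m k t x
      ≤ 5400 * c₂ * (m + 4) ^ 4 / c₁ * κ ^ 2 *
        ((∫ x, ζ x ^ (m + 2) * gsq U x) + κ ^ 2 * M ^ 2 * ∫ x, ζ x) := by
  have hce := cacc_est hU hdiv hS hsym hW hc₂ hup hζ h0 h1 hr hκ hM hd hdd hm hUM ht ht1 hcl k
  have hζc : Continuous ζ := hζ.continuous
  set z := t • ee k with hz
  have hsh : ∀ {f : E3 → ℝ}, Continuous f → Continuous fun x => f (x + z) := fun hf => by fun_prop
  have i1 : Integrable fun x => ζ x ^ (m + 4) *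
      (frob (S (x + z) - S x) (eps U (x + z) - eps U x) / t ^ 2) := by
    refine int_cs ((hζc.pow _).mul (Continuous.div_const (cont_frob (fun i j => ?_) (fun i j => ?_)) _))
      (r := r) fun x hx => by simp [hr x hx]
    · exact (hsh (hS i j)).sub (hS i j)
    · exact (hsh (eps_cont hU i j)).sub (eps_cont hU i j)
  have i2 : Integrable (YY μ U ζ m k t) := int_cs (YY_cont hU μ hζc m k t) (r := r) fun x hx => by
    simp [YY, hr x hx]
  have key : ∀ x, YY μ U ζ m k t x ≤ 4 / c₁ * (ζ x ^ (m + 4) *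
      (frob (S (x + z) - S x) (eps U (x + z) - eps U x) / t ^ 2)) := by
    intro x
    rcases le_or_gt ‖x‖ r with hx | hx
    · have hζx := h0 x
      have n1 := fnorm_nonneg (eps U x)
      have n2 := fnorm_nonneg (eps U (x + z))
      have n3 := (abs_le.1 (hfn x hx k)).2
      have w1 : wgt μ U x ≤ 4 * (1 + fnorm (eps U (x + z)) + fnorm (eps U x)) ^ (-μ) := by
        have b1 : (2 * (1 + fnorm (eps U x))) ^ (-μ)
            ≤ (1 + fnorm (eps U (x + z)) + fnorm (eps U x)) ^ (-μ) :=
          Real.rpow_le_rpow_of_nonpos (by linarith) (by linarith) (by linarith)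
        rw [Real.mul_rpow (by norm_num) (by linarith)] at b1
        have b2 : (1 / 4 : ℝ) ≤ 2 ^ (-μ) := by
          have : (2 : ℝ) ^ (-2 : ℝ) ≤ 2 ^ (-μ) :=
            Real.rpow_le_rpow_of_exponent_le (by norm_num) (by linarith)
          refine le_trans (le_of_eq ?_) this
          rw [Real.rpow_neg (by norm_num)]; norm_num
        have b3 := wgt_pos μ U x
        unfold wgt at b3 ⊢
        nlinarith
      have f1 := frob_self_nonneg (eps U (x + z) - eps U x)
      have l1 := hlow (x + z) x
      have l2 : wgt μ U x * frob (eps U (x + z) - eps U x) (eps U (x + z) - eps U x)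
          ≤ 4 / c₁ * frob (S (x + z) - S x) (eps U (x + z) - eps U x) := by
        calc _ ≤ 4 * (1 + fnorm (eps U (x + z)) + fnorm (eps U x)) ^ (-μ)
              * frob (eps U (x + z) - eps U x) (eps U (x + z) - eps U x) :=
              mul_le_mul_of_nonneg_right w1 f1
          _ = 4 / c₁ * (c₁ * (1 + fnorm (eps U (x + z)) + fnorm (eps U x)) ^ (-μ)
              * frob (eps U (x + z) - eps U x) (eps U (x + z) - eps U x)) := by field_simp
          _ ≤ _ := mul_le_mul_of_nonneg_left l1 (by positivity)
      have l3 := mul_le_mul_of_nonneg_left (div_le_div_of_nonneg_right l2 (sq_nonneg t))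
        (pow_nonneg hζx (m + 4))
      unfold YY
      rw [← hz]
      refine le_trans (le_of_eq ?_) (l3.trans (le_of_eq ?_)) <;> ring
    · simp [YY, hr x hx.le]
  have := integral_mono i2 (i1.const_mul (4 / c₁)) key
  refine this.trans ?_
  rw [integral_const_mul]
  refine (mul_le_mul_of_nonneg_left hce (by positivity)).trans (le_of_eq ?_)
  ring

set_option maxHeartbeats 2000000 in
lemma main_est {U : Fin 3 → E3 → ℝ} (hU : ∀ i, ContDiff ℝ 1 (U i)) (hdiv : ∀ x, ∑ i, dd i (U i) x = 0)
    {S : E3 → Matrix (Fin 3) (Fin 3) ℝ} (hS : ∀ i j, Continuous fun x => S x i j)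
    (hsym : ∀ x i j, S x i j = S x j i) (hW : WeakC1 S) {c₁ c₂ μ : ℝ} (hc₁ : 0 < c₁) (hc₂ : 0 < c₂)
    (hμ₁ : 1 < μ) (hμ₂ : μ < 2)
    (hlow : ∀ x y, c₁ * (1 + fnorm (eps U x) + fnorm (eps U y)) ^ (-μ)
      * frob (eps U x - eps U y) (eps U x - eps U y) ≤ frob (S x - S y) (eps U x - eps U y))
    (hup : ∀ x y, frob (S x - S y) (S x - S y) ≤ c₂ * frob (S x - S y) (eps U x - eps U y))
    {ζ : E3 → ℝ} (hζ : ContDiff ℝ (⊤ : ℕ∞) ζ) (h0 : ∀ x, 0 ≤ ζ x) (h1 : ∀ x, ζ x ≤ 1)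
    {κ M r : ℝ} (hr : ∀ x, r ≤ ‖x‖ → ζ x = 0) (hκ : 0 < κ) (hM : 0 < M)
    (hd : ∀ j x, |dd j ζ x| ≤ κ) (hdd : ∀ i j x, |dd i (dd j ζ) x| ≤ κ ^ 2) {m N : ℕ}
    (hmN : m = 2 * N + 1) (hN : μ ≤ N * (2 - μ))
    (hUM : ∀ i x, ‖x‖ ≤ r + 1 → |U i x| ≤ M) {C₁ : ℝ} (hC₁ : C₁ = 5400 * c₂ * (m + 4) ^ 4 / c₁)
    (hsmall : 10368 * C₁ * κ ^ 2 * M ^ 2 ≤ 1) :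
    (∫ x, ζ x ^ (m + 2) * gsq U x) ≤ (1 + 3888 * C₁ + 1944 * (m + 2) ^ 2) * (κ ^ 2 * M ^ 2 * ∫ x, ζ x) ∧
    ∀ᶠ t in nhdsWithin (0 : ℝ) (Set.Ioi 0), ∀ k, ∫ x, YY μ U ζ m k t x
      ≤ C₁ * κ ^ 2 * ((∫ x, ζ x ^ (m + 2) * gsq U x) + κ ^ 2 * M ^ 2 * ∫ x, ζ x) := by
  have hm : 1 ≤ m := by omega
  have hζc : Continuous ζ := hζ.continuous
  have hκM : 0 < κ * M := by positivity
  have hC₁0 : 0 < C₁ := by rw [hC₁]; positivity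
  have hYev : ∀ᶠ t in nhdsWithin (0 : ℝ) (Set.Ioi 0), ∀ k, ∫ x, YY μ U ζ m k t x
      ≤ C₁ * κ ^ 2 * ((∫ x, ζ x ^ (m + 2) * gsq U x) + κ ^ 2 * M ^ 2 * ∫ x, ζ x) := by
    have e1 : ∀ᶠ t in nhdsWithin (0 : ℝ) (Set.Ioi 0), ∀ i j : Fin 3, ∀ x, ‖x‖ ≤ r → ∀ k, ∀ s : ℝ, |s| ≤ 1 →
        |dd j (U i) (x + s • t • ee k) - dd j (U i) x| ≤ κ * M :=
      eventually_all.2 fun i => eventually_all.2 fun j => unif_ev (dd_cont (hU i) j) r hκM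
    filter_upwards [e1, unif_ev (cont_fnorm (eps_cont hU)) r one_pos, Ioo_mem_nhdsGT one_pos]
      with t t1 t2 t3 k
    have := Y_est hU hdiv hS hsym hW hc₁ hc₂ hμ₁ hμ₂ hlow hup hζ h0 h1 hr hκ hM hd hdd hm hUM t3.1 t3.2.le
      t1 (fun x hx k => by
        have := t2 x hx k 1 (by simp)
        rwa [one_smul] at this) k
    rw [← hC₁] at this
    exact this
  refine ⟨?_, hYev⟩
  set X := ∫ x, ζ x ^ (m + 2) * gsq U x with hX
  set J := ∫ x, ζ x with hJ
  have hX0 : 0 ≤ X := integral_nonneg fun x => mul_nonneg (pow_nonneg (h0 x) _) (gsq_nonneg U x)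
  have hJ0 : 0 ≤ J := integral_nonneg h0
  set a : E3 → ℝ := fun y => ζ y ^ (m + 2) with ha
  have hac : ContDiff ℝ 1 a := (contDiff_infty.1 hζ 1).pow _
  have har : ∀ x, r ≤ ‖x‖ → a x = 0 := fun x hx => by simp [ha, hr x hx]
  have i3 : Integrable fun x => ζ x ^ (m + 2) * gsq U x :=
    int_cs ((hζc.pow _).mul (gsq_cont hU)) (r := r) fun x hx => by simp [hr x hx]
  have i4 : Integrable ζ := int_cs hζc hr
  have epsP : ∀ i j x, eps U x i j ^ 2 ≤ gsq U x := fun i j x =>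
    (entry_sq_le _ i j).trans (eps_sq_le U x)
  have hkorn := korn_id hU hdiv hac har
  have hK : ∑ i, ∑ j, ∫ x, dd i a x * dd j (U i) x * U j x
      ≤ 9 * (X / 144 + 36 * (m + 2) ^ 2 * κ ^ 2 * M ^ 2 * J) := by
    have : ∀ i j : Fin 3, ∫ x, dd i a x * dd j (U i) x * U j x
        ≤ X / 144 + 36 * (m + 2) ^ 2 * κ ^ 2 * M ^ 2 * J := fun i j =>
      (le_abs_self _).trans (cut_term hU hζ h0 h1 hr hκ hM hd hdd hm hUM (dd_cont (hU i) j)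
        (fun x => dd_sq_le_gsq U x i j) j i)
    refine (Finset.sum_le_sum fun i _ => Finset.sum_le_sum fun j _ => this i j).trans (le_of_eq ?_)
    simp only [Finset.sum_const, Finset.card_univ, Fintype.card_fin, nsmul_eq_mul]
    push_cast; ring
  set lam := 1 / (144 * C₁ * κ ^ 2) with hlam
  have hlam0 : 0 < lam := by positivity
  have step : ∀ η > 0, ∑ i, ∑ j, ∫ x, a x * eps U x i j * dd j (U i) x
      ≤ 9 * (η + (lam * (C₁ * κ ^ 2 * (X + κ ^ 2 * M ^ 2 * J)) + M ^ 2 / (4 * lam) * (3 * J + 2 * X))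
        + (X / 144 + 36 * (m + 2) ^ 2 * κ ^ 2 * M ^ 2 * J)) := by
    intro η hη
    have e1 : ∀ᶠ t in nhdsWithin (0 : ℝ) (Set.Ioi 0), ∀ i j : Fin 3,
        |(∫ x, a x * eps U x i j * dd j (U i) x)
          + (∫ x, a x * ((eps U (x + t • ee j) i j - eps U x i j) / t) * U i x)
          + ∫ x, dd j a x * eps U x i j * U i x| ≤ η :=
      eventually_all.2 fun i => eventually_all.2 fun j =>
        interp_limit hac (eps_cont hU i j) (hU i) har j hη
    obtain ⟨t, ⟨tY, tI⟩, tpos⟩ := ((hYev.and e1).and self_mem_nhdsWithin).exists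
    have tpos : 0 < t := tpos
    have main : ∀ i j : Fin 3, ∫ x, a x * eps U x i j * dd j (U i) x
        ≤ η + (lam * (C₁ * κ ^ 2 * (X + κ ^ 2 * M ^ 2 * J)) + M ^ 2 / (4 * lam) * (3 * J + 2 * X))
        + (X / 144 + 36 * (m + 2) ^ 2 * κ ^ 2 * M ^ 2 * J) := by
      intro i j
      have a1 := (abs_le.1 (tI i j)).2
      have a2 := cut_term hU hζ h0 h1 hr hκ hM hd hdd hm hUM (eps_cont hU i j) (epsP i j) i j
      have a2' := neg_le_of_abs_le a2
      have iY : Integrable (YY μ U ζ m j t) := int_cs (YY_cont hU μ hζc m j t) (r := r) fun x hx => by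
        simp [YY, hr x hx]
      have i43 : Integrable fun x => 3 * ζ x + 2 * (ζ x ^ (m + 2) * gsq U x) :=
        (i4.const_mul 3).add (i3.const_mul 2)
      have a3 : |∫ x, a x * ((eps U (x + t • ee j) i j - eps U x i j) / t) * U i x|
          ≤ lam * (∫ x, YY μ U ζ m j t x) + M ^ 2 / (4 * lam) * (3 * J + 2 * X) := by
        have hnorm_int := norm_integral_le_of_norm_le
          (f := fun x => a x * ((eps U (x + t • ee j) i j - eps U x i j) / t) * U i x)
          (g := fun x => lam * YY μ U ζ m j t x
            + M ^ 2 / (4 * lam) * (3 * ζ x + 2 * (ζ x ^ (m + 2) * gsq U x)))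
          ((iY.const_mul lam).add (i43.const_mul (M ^ 2 / (4 * lam))))
          (Eventually.of_forall fun x => by
            have hζx := h0 x
            rw [Real.norm_eq_abs, abs_mul, abs_mul]
            rcases le_or_gt ‖x‖ r with hx | hx
            · have q2 := hUM i x (by linarith)
              set s := (eps U (x + t • ee j) i j - eps U x i j) / t with hs
              have hs2 : s ^ 2 ≤ frob (eps U (x + t • ee j) - eps U x) (eps U (x + t • ee j) - eps U x)
                  / t ^ 2 := by
                rw [hs, div_pow]
                exact div_le_div_of_nonneg_right
                  (entry_sq_le (eps U (x + t • ee j) - eps U x) i j) (sq_nonneg t)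
              set w := 1 + fnorm (eps U x) with hw
              have hw1 : 1 ≤ w := by have := fnorm_nonneg (eps U x); linarith
              have hw0 : 0 < w := by linarith
              have hwb := weight_bound hμ₂ hN hζx hw1
              rw [← hmN] at hwb
              have hww : w ^ 2 ≤ 2 + 2 * gsq U x := by
                have := fnorm_sq (eps U x)
                have h5 := eps_sq_le U x
                rw [hw]; nlinarith [sq_nonneg (1 - fnorm (eps U x))]
              have hζm2 : ζ x ^ (m + 2) ≤ ζ x := pow_le_of_le_one hζx (h1 x) (by omega)
              have hwb2 : ζ x ^ m * w ^ μ ≤ 3 * ζ x + 2 * (ζ x ^ (m + 2) * gsq U x) := by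
                have := mul_le_mul_of_nonneg_left hww (pow_nonneg hζx (m + 2))
                nlinarith
              have hwg : wgt μ U x * w ^ μ = 1 := by
                unfold wgt
                rw [← hw, ← Real.rpow_add hw0]; simp
              have hwp : 0 < w ^ μ := Real.rpow_pos_of_pos hw0 _
              have hgp := wgt_pos μ U x
              have young : ζ x ^ 2 * |s| * M ≤ lam * (ζ x ^ 4 * (wgt μ U x * s ^ 2))
                  + M ^ 2 / (4 * lam) * w ^ μ := by
                have e : lam * (ζ x ^ 4 * (wgt μ U x * s ^ 2)) + M ^ 2 / (4 * lam) * w ^ μ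
                    - ζ x ^ 2 * |s| * M
                    = w ^ μ * (2 * lam * ζ x ^ 2 * |s| * wgt μ U x - M) ^ 2 / (4 * lam) := by
                  have : wgt μ U x = 1 / w ^ μ := by field_simp; exact hwg
                  rw [this, ← sq_abs s]
                  field_simp
                  ring
                have : 0 ≤ w ^ μ * (2 * lam * ζ x ^ 2 * |s| * wgt μ U x - M) ^ 2 / (4 * lam) := by
                  positivity
                linarith
              have haa : |a x| = ζ x ^ (m + 2) := abs_of_nonneg (pow_nonneg hζx _)
              rw [haa]
              calc ζ x ^ (m + 2) * |s| * |U i x| ≤ ζ x ^ (m + 2) * |s| * M := by gcongr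
                _ = ζ x ^ m * (ζ x ^ 2 * |s| * M) := by ring
                _ ≤ ζ x ^ m * (lam * (ζ x ^ 4 * (wgt μ U x * s ^ 2)) + M ^ 2 / (4 * lam) * w ^ μ) := by
                  gcongr
                _ = lam * (ζ x ^ (m + 4) * (wgt μ U x * s ^ 2))
                    + M ^ 2 / (4 * lam) * (ζ x ^ m * w ^ μ) := by ring
                _ ≤ _ := by
                  unfold YY
                  gcongr
            · have hz := hr x hx.le
              simp [YY, hz, ha])
        rw [integral_add (iY.const_mul lam) (i43.const_mul _), integral_const_mul, integral_const_mul,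
          integral_add (i4.const_mul 3) (i3.const_mul 2), integral_const_mul, integral_const_mul] at hnorm_int
        exact hnorm_int
      have a4 := neg_le_of_abs_le a3
      have a5 := mul_le_mul_of_nonneg_left (tY j) hlam0.le
      linarith
    refine (Finset.sum_le_sum fun i _ => Finset.sum_le_sum fun j _ => main i j).trans (le_of_eq ?_)
    simp only [Finset.sum_const, Finset.card_univ, Fintype.card_fin, nsmul_eq_mul]
    push_cast; ring
  have hl1 : lam * (C₁ * κ ^ 2 * (X + κ ^ 2 * M ^ 2 * J)) = (X + κ ^ 2 * M ^ 2 * J) / 144 := by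
    rw [hlam]; field_simp
  have hl2 : M ^ 2 / (4 * lam) = 36 * C₁ * κ ^ 2 * M ^ 2 := by
    rw [hlam]; field_simp; ring
  have hsX : 10368 * C₁ * κ ^ 2 * M ^ 2 * X ≤ 1 * X := mul_le_mul_of_nonneg_right hsmall hX0
  have fin : ∀ η > 0, X ≤ (1 + 3888 * C₁ + 1944 * (m + 2) ^ 2) * (κ ^ 2 * M ^ 2 * J) + η := by
    intro η hη
    have s1 := step (η / 32) (by positivity)
    rw [hl1, hl2] at s1
    have hx2 : X = 2 * (∑ i, ∑ j, ∫ x, a x * eps U x i j * dd j (U i) x)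
      + ∑ i, ∑ j, ∫ x, dd i a x * dd j (U i) x * U j x := hkorn
    set L := κ ^ 2 * M ^ 2 * J with hL
    have hL0 : 0 ≤ L := by positivity
    have k1 : 36 * ((m : ℝ) + 2) ^ 2 * κ ^ 2 * M ^ 2 * J = 36 * ((m + 2) ^ 2 * L) := by rw [hL]; ring
    have k2 : 36 * C₁ * κ ^ 2 * M ^ 2 * (3 * J + 2 * X) = 108 * (C₁ * L) + 72 * C₁ * κ ^ 2 * M ^ 2 * X := by
      rw [hL]; ring
    rw [k1] at hK s1
    rw [k2] at s1
    have k3 : 0 ≤ ((m : ℝ) + 2) ^ 2 * L := by positivity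
    have k4 : 0 ≤ C₁ * L := by positivity
    nlinarith
  exact le_of_forall_pos_le_add fin

end

section
open MeasureTheory Real Filter

lemma shift_le {G : E3 → ℝ} (hG : Continuous G) (hG0 : ∀ x, 0 ≤ G x) {r s : ℝ} {w : E3} (hw : ‖w‖ ≤ s) :
    ∫ x in Metric.closedBall (0 : E3) r, G (x + w) ≤ ∫ x in Metric.closedBall (0 : E3) (r + s), G x := by
  rw [← integral_indicator measurableSet_closedBall, ← integral_indicator measurableSet_closedBall]
  have hi : Integrable (Set.indicator (Metric.closedBall (0 : E3) (r + s)) G) :=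
    (integrable_indicator_iff measurableSet_closedBall).2
      (hG.continuousOn.integrableOn_compact (isCompact_closedBall _ _))
  have e := integral_add_right_eq_self (μ := (volume : Measure E3))
    (Set.indicator (Metric.closedBall (0 : E3) (r + s)) G) w
  refine le_trans ?_ (le_of_eq e)
  refine integral_mono ?_ (hi.comp_add_right w) ?_
  · exact (integrable_indicator_iff measurableSet_closedBall).2
      ((by fun_prop : Continuous fun x => G (x + w)).continuousOn.integrableOn_compact (isCompact_closedBall _ _))
  · intro x
    by_cases hx : x ∈ Metric.closedBall (0 : E3) r
    · have : x + w ∈ Metric.closedBall (0 : E3) (r + s) := by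
        simp only [Metric.mem_closedBall, dist_zero_right] at hx ⊢
        exact (norm_add_le _ _).trans (add_le_add hx hw)
      simp [Set.indicator_of_mem hx, Set.indicator_of_mem this]
    · simp only [Set.indicator_of_notMem hx]
      exact Set.indicator_nonneg (fun y _ => hG0 y) _

lemma const_of_dq {f : E3 → ℝ} (hf : Continuous f) {v : E3} (hv : ‖v‖ ≤ 1)
    (H : ∀ r η : ℝ, 0 < r → 0 < η → ∀ᶠ t in nhdsWithin (0 : ℝ) (Set.Ioi 0),
      ∫ x in Metric.closedBall (0 : E3) r, (f (x + t • v) - f x) ^ 2 ≤ η * t ^ 2) {s : ℝ} (hs : 0 < s) (x₀ : E3) :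
    f (x₀ + s • v) = f x₀ := by
  set r := ‖x₀‖ + 1 with hr
  have hr0 : 0 < r := by positivity
  set F : E3 → ℝ := fun x => (f (x + s • v) - f x) ^ 2 with hF
  have hFc : Continuous F := by fun_prop
  have hF0 : ∀ x, 0 ≤ F x := fun x => sq_nonneg _
  have hFi : IntegrableOn F (Metric.closedBall (0 : E3) r) :=
    hFc.continuousOn.integrableOn_compact (isCompact_closedBall _ _)
  have key : ∀ η : ℝ, 0 < η → ∫ x in Metric.closedBall (0 : E3) r, F x ≤ η * s ^ 2 := by
    intro η hη
    have ht : Tendsto (fun n : ℕ => s / (n : ℝ)) atTop (nhdsWithin (0 : ℝ) (Set.Ioi 0)) := by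
      refine tendsto_nhdsWithin_iff.2 ⟨tendsto_const_div_atTop_nhds_zero_nat s, ?_⟩
      filter_upwards [eventually_gt_atTop 0] with n hn
      exact div_pos hs (by exact_mod_cast hn)
    obtain ⟨n, hn, hn0⟩ := ((ht.eventually (H (r + s) η (by positivity) hη)).and (eventually_gt_atTop 0)).exists
    have hnp : (0 : ℝ) < n := by exact_mod_cast hn0
    set t := s / (n : ℝ) with htd
    have hnt : (n : ℝ) * t = s := by rw [htd]; field_simp
    have ht0 : 0 < t := div_pos hs hnp
    set G : E3 → ℝ := fun y => (f (y + t • v) - f y) ^ 2 with hG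
    have hGc : Continuous G := by fun_prop
    have hG0 : ∀ x, 0 ≤ G x := fun x => sq_nonneg _
    have hGi : ∀ i : ℕ, IntegrableOn (fun x => G (x + ((i : ℝ) * t) • v)) (Metric.closedBall (0 : E3) r) := fun i =>
      (by fun_prop : Continuous (fun x => G (x + ((i : ℝ) * t) • v))).continuousOn.integrableOn_compact
        (isCompact_closedBall _ _)
    have pw : ∀ x, F x ≤ n * ∑ i ∈ Finset.range n, G (x + ((i : ℝ) * t) • v) := by
      intro x
      have e : f (x + s • v) - f x = ∑ i ∈ Finset.range n,
          (f (x + ((i : ℝ) * t) • v + t • v) - f (x + ((i : ℝ) * t) • v)) := by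
        have := Finset.sum_range_sub (fun i : ℕ => f (x + ((i : ℝ) * t) • v)) n
        simp only [hnt] at this
        simp only [Nat.cast_zero, zero_mul, zero_smul, add_zero] at this
        rw [← this]
        refine Finset.sum_congr rfl fun i _ => ?_
        congr 2
        push_cast
        rw [add_mul, one_mul, add_smul, add_assoc]
      have := sq_sum_le_card_mul_sum_sq (s := Finset.range n)
        (f := fun i : ℕ => f (x + ((i : ℝ) * t) • v + t • v) - f (x + ((i : ℝ) * t) • v))
      rw [← e, Finset.card_range] at this
      exact this
    calc ∫ x in Metric.closedBall (0 : E3) r, F x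
        ≤ ∫ x in Metric.closedBall (0 : E3) r, n * ∑ i ∈ Finset.range n, G (x + ((i : ℝ) * t) • v) :=
          integral_mono hFi ((integrable_finsetSum _ fun i _ => hGi i).const_mul _) pw
      _ = n * ∑ i ∈ Finset.range n, ∫ x in Metric.closedBall (0 : E3) r, G (x + ((i : ℝ) * t) • v) := by
          rw [integral_const_mul, integral_finsetSum _ fun i _ => hGi i]
      _ ≤ n * ∑ i ∈ Finset.range n, η * t ^ 2 := by
          refine mul_le_mul_of_nonneg_left (Finset.sum_le_sum fun i hi => ?_) hnp.le
          refine (shift_le hGc hG0 (s := s) ?_).trans hn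
          rw [norm_smul, Real.norm_of_nonneg (by positivity)]
          have : (i : ℝ) ≤ n := by exact_mod_cast (Finset.mem_range.1 hi).le
          calc (i : ℝ) * t * ‖v‖ ≤ i * t * 1 := mul_le_mul_of_nonneg_left hv (by positivity)
            _ ≤ n * t := by rw [mul_one]; exact mul_le_mul_of_nonneg_right this ht0.le
            _ = s := hnt
      _ = η * s ^ 2 := by
          rw [Finset.sum_const, Finset.card_range, nsmul_eq_mul, ← hnt]; ring
  have hz : ∫ x in Metric.closedBall (0 : E3) r, F x = 0 := by
    refine le_antisymm (le_of_forall_pos_le_add fun η hη => ?_) (integral_nonneg hF0)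
    have := key (η / s ^ 2) (by positivity)
    rw [div_mul_cancel₀ _ (by positivity)] at this
    linarith
  have hae : F =ᵐ[volume.restrict (Metric.closedBall (0 : E3) r)] 0 :=
    (setIntegral_eq_zero_iff_of_nonneg_ae (Eventually.of_forall hF0) hFi).1 hz
  have hae2 : F =ᵐ[volume.restrict (Metric.ball (0 : E3) r)] (fun _ => (0 : ℝ)) :=
    ae_restrict_of_ae_restrict_of_subset Metric.ball_subset_closedBall hae
  have := Measure.eqOn_open_of_ae_eq hae2 Metric.isOpen_ball hFc.continuousOn continuousOn_const
    (show x₀ ∈ Metric.ball (0 : E3) r by simp [hr])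
  have h2 : f (x₀ + s • v) - f x₀ = 0 := by simpa [hF] using this
  linarith

lemma const_of_dirs {f : E3 → ℝ} (H : ∀ k, ∀ s : ℝ, 0 < s → ∀ x, f (x + s • ee k) = f x) (x : E3) : f x = f 0 := by
  have H2 : ∀ k, ∀ s : ℝ, ∀ x, f (x + s • ee k) = f x := by
    intro k s x
    rcases lt_trichotomy s 0 with hs | hs | hs
    · have := H k (-s) (by linarith) (x + s • ee k)
      rw [← this]; congr 1; module
    · simp [hs]
    · exact H k s hs x
  have e : x = 0 + x 0 • ee 0 + x 1 • ee 1 + x 2 • ee 2 := by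
    ext i; fin_cases i <;> simp [ee]
  rw [e, H2, H2, H2]

end

section
open MeasureTheory Real Filter

lemma pack {U : Fin 3 → E3 → ℝ} (hU : ∀ i, ContDiff ℝ 1 (U i)) (hdiv : ∀ x, ∑ i, dd i (U i) x = 0)
    {S : E3 → Matrix (Fin 3) (Fin 3) ℝ} (hS : ∀ i j, Continuous fun x => S x i j)
    (hsym : ∀ x i j, S x i j = S x j i) (hW : WeakC1 S) {c₁ c₂ μ : ℝ} (hc₁ : 0 < c₁) (hc₂ : 0 < c₂)
    (hμ₁ : 1 < μ) (hμ₂ : μ < 2)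
    (hlow : ∀ x y, c₁ * (1 + fnorm (eps U x) + fnorm (eps U y)) ^ (-μ)
      * frob (eps U x - eps U y) (eps U x - eps U y) ≤ frob (S x - S y) (eps U x - eps U y))
    (hup : ∀ x y, frob (S x - S y) (S x - S y) ≤ c₂ * frob (S x - S y) (eps U x - eps U y))
    {C₀ α : ℝ} (hC₀ : 0 < C₀) (hα₀ : 0 ≤ α) (hα : α < 1 / 2)
    (hUM : ∀ i x, |U i x| ≤ C₀ * (1 + ‖x‖) ^ α) :
    ∃ A : ℝ, 0 < A ∧ ∃ m : ℕ, ∃ R₀ : ℝ, 1 ≤ R₀ ∧ ∀ R, R₀ ≤ R → ∃ ζ : E3 → ℝ, Continuous ζ ∧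
      (∀ x, 0 ≤ ζ x) ∧ (∀ x, ‖x‖ ≤ R → ζ x = 1) ∧ (∀ x, 2 * R ≤ ‖x‖ → ζ x = 0) ∧
      (∫ x, ζ x ^ (m + 2) * gsq U x) ≤ A * R ^ (1 + 2 * α) ∧
      ∀ᶠ t in nhdsWithin (0 : ℝ) (Set.Ioi 0), ∀ k, ∫ x, YY μ U ζ m k t x ≤ A * R ^ (2 * α - 1) := by
  obtain ⟨Nc, hNc, hcut⟩ := cutoff_exists
  obtain ⟨N, hN⟩ := exists_nat_ge (μ / (2 - μ))
  have hN' : μ ≤ N * (2 - μ) := by rwa [div_le_iff₀ (by linarith)] at hN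
  obtain ⟨m, hmN⟩ : ∃ m : ℕ, m = 2 * N + 1 := ⟨_, rfl⟩
  obtain ⟨C₁, hC₁⟩ : ∃ C₁ : ℝ, C₁ = 5400 * c₂ * (m + 4) ^ 4 / c₁ := ⟨_, rfl⟩
  have hC₁0 : 0 < C₁ := by rw [hC₁]; positivity
  obtain ⟨K, hK⟩ : ∃ K : ℝ, K = 4 * Nc ^ 2 * C₀ ^ 2 := ⟨_, rfl⟩
  have hK0 : 0 < K := by rw [hK]; positivity
  obtain ⟨D, hD⟩ : ∃ D : ℝ, D = 1 + 3888 * C₁ + 1944 * ((m : ℝ) + 2) ^ 2 := ⟨_, rfl⟩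
  have hD0 : 0 < D := by rw [hD]; positivity
  have hlim : Tendsto (fun R : ℝ => 10368 * C₁ * K * R ^ (-(2 - 2 * α))) atTop (nhds 0) := by
    simpa using (tendsto_rpow_neg_atTop (show 0 < 2 - 2 * α by linarith)).const_mul (10368 * C₁ * K)
  obtain ⟨R₁, hR₁⟩ := eventually_atTop.1 (hlim.eventually (ge_mem_nhds (zero_lt_one' ℝ)))
  refine ⟨D * K * Nc + C₁ * Nc ^ 2 * ((D + 1) * K * Nc), by positivity, m, max 1 R₁, le_max_left _ _, ?_⟩
  intro R hR
  have hR1 : 1 ≤ R := (le_max_left _ _).trans hR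
  have hR0 : 0 < R := by linarith
  have hsm := hR₁ R ((le_max_right _ _).trans hR)
  obtain ⟨ζ, hζ, z0, z1, zR, z2R, zd, zdd, zI⟩ := hcut R hR1
  have hRα : 0 < R ^ α := Real.rpow_pos_of_pos hR0 _
  have e1 : (Nc / R) ^ 2 * (2 * C₀ * R ^ α) ^ 2 = K * R ^ (-(2 - 2 * α)) := by
    have : R ^ (-(2 - 2 * α)) = (R ^ α) ^ 2 / R ^ 2 := by
      rw [show -(2 - 2 * α) = α + α - (2 : ℕ) by push_cast; ring, Real.rpow_sub hR0, Real.rpow_add hR0, Real.rpow_natCast]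
      ring
    rw [this, hK]; field_simp; ring
  have e2 : K * R ^ (-(2 - 2 * α)) * R ^ 3 = K * R ^ (1 + 2 * α) := by
    rw [mul_assoc, ← Real.rpow_natCast R 3, ← Real.rpow_add hR0]; congr 2; push_cast; ring
  have e3 : R ^ (1 + 2 * α) = R ^ (2 * α - 1) * R ^ 2 := by
    rw [← Real.rpow_natCast R 2, ← Real.rpow_add hR0]; congr 1; push_cast; ring
  have hb : (Nc / R) ^ 2 * (2 * C₀ * R ^ α) ^ 2 * ∫ x, ζ x ≤ K * Nc * R ^ (1 + 2 * α) := by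
    rw [e1]
    have p : 0 < R ^ (-(2 - 2 * α)) := Real.rpow_pos_of_pos hR0 _
    refine (mul_le_mul_of_nonneg_left zI (by positivity)).trans (le_of_eq ?_)
    linear_combination Nc * e2
  have hMb : ∀ i x, ‖x‖ ≤ 2 * R + 1 → |U i x| ≤ 2 * C₀ * R ^ α := by
    intro i x hx
    refine (hUM i x).trans ?_
    have b1 : (1 + ‖x‖) ^ α ≤ (4 * R) ^ α :=
      Real.rpow_le_rpow (by positivity) (by linarith) hα₀
    rw [Real.mul_rpow (by norm_num) hR0.le] at b1
    have b2 : (4 : ℝ) ^ α ≤ 2 := by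
      calc (4 : ℝ) ^ α ≤ 4 ^ (1 / 2 : ℝ) := Real.rpow_le_rpow_of_exponent_le (by norm_num) hα.le
        _ = 2 := by
          rw [← Real.sqrt_eq_rpow, show (4 : ℝ) = 2 ^ 2 by norm_num, Real.sqrt_sq (by norm_num)]
    have b3 := b1.trans (mul_le_mul_of_nonneg_right b2 hRα.le)
    refine (mul_le_mul_of_nonneg_left b3 hC₀.le).trans (le_of_eq ?_)
    ring
  obtain ⟨r1, r2⟩ := main_est hU hdiv hS hsym hW hc₁ hc₂ hμ₁ hμ₂ hlow hup hζ z0 z1 z2R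
    (κ := Nc / R) (M := 2 * C₀ * R ^ α) (by positivity) (by positivity) zd zdd hmN hN' hMb hC₁
    (by rw [mul_assoc, e1]; linarith)
  rw [← hD] at r1
  have r3 : (∫ x, ζ x ^ (m + 2) * gsq U x) ≤ D * (K * Nc * R ^ (1 + 2 * α)) :=
    r1.trans (mul_le_mul_of_nonneg_left hb hD0.le)
  have p1 : 0 < R ^ (1 + 2 * α) := Real.rpow_pos_of_pos hR0 _
  have p2 : 0 < R ^ (2 * α - 1) := Real.rpow_pos_of_pos hR0 _
  refine ⟨ζ, hζ.continuous, z0, zR, z2R, r3.trans ?_, r2.mono fun t ht k => (ht k).trans ?_⟩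
  · have : 0 ≤ C₁ * Nc ^ 2 * ((D + 1) * K * Nc) * R ^ (1 + 2 * α) := by positivity
    linarith
  · have h1 : C₁ * (Nc / R) ^ 2 * ((∫ x, ζ x ^ (m + 2) * gsq U x) + (Nc / R) ^ 2 * (2 * C₀ * R ^ α) ^ 2 * ∫ x, ζ x)
        ≤ C₁ * (Nc / R) ^ 2 * (D * (K * Nc * R ^ (1 + 2 * α)) + K * Nc * R ^ (1 + 2 * α)) :=
      mul_le_mul_of_nonneg_left (add_le_add r3 hb) (by positivity)
    refine h1.trans ?_
    have h2 : C₁ * (Nc / R) ^ 2 * (D * (K * Nc * R ^ (1 + 2 * α)) + K * Nc * R ^ (1 + 2 * α))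
        = C₁ * Nc ^ 2 * ((D + 1) * K * Nc) * R ^ (2 * α - 1) := by
      rw [e3]; field_simp
    rw [h2]
    have : 0 ≤ D * K * Nc * R ^ (2 * α - 1) := by positivity
    linarith

/-- the symmetric gradient is constant -/
lemma eps_const {U : Fin 3 → E3 → ℝ} (hU : ∀ i, ContDiff ℝ 1 (U i)) {μ A α : ℝ} (hA : 0 < A) (hα : α < 1 / 2)
    {m : ℕ} {R₀ : ℝ} (hR₀ : 1 ≤ R₀)
    (H : ∀ R, R₀ ≤ R → ∃ ζ : E3 → ℝ, Continuous ζ ∧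
      (∀ x, 0 ≤ ζ x) ∧ (∀ x, ‖x‖ ≤ R → ζ x = 1) ∧ (∀ x, 2 * R ≤ ‖x‖ → ζ x = 0) ∧
      (∫ x, ζ x ^ (m + 2) * gsq U x) ≤ A * R ^ (1 + 2 * α) ∧
      ∀ᶠ t in nhdsWithin (0 : ℝ) (Set.Ioi 0), ∀ k, ∫ x, YY μ U ζ m k t x ≤ A * R ^ (2 * α - 1)) (x : E3) (i j : Fin 3) :
    eps U x i j = eps U 0 i j := by
  refine const_of_dirs (f := fun x => eps U x i j) (fun k s hs x => ?_) x
  refine const_of_dq (eps_cont hU i j) (norm_ee k).le (fun r η hr hη => ?_) hs x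
  obtain ⟨x₁, -, hx₁⟩ := (isCompact_closedBall (0 : E3) r).exists_isMinOn ⟨0, by simp [hr.le]⟩ (wgt_cont hU μ).continuousOn
  have hw := wgt_pos μ U x₁
  have hlim : Tendsto (fun R : ℝ => A * R ^ (-(1 - 2 * α))) atTop (nhds 0) := by
    simpa using (tendsto_rpow_neg_atTop (show 0 < 1 - 2 * α by linarith)).const_mul A
  obtain ⟨R, hR, hRR, hRr⟩ := ((hlim.eventually (ge_mem_nhds (show 0 < wgt μ U x₁ * η by positivity))).and
    ((eventually_ge_atTop R₀).and (eventually_ge_atTop r))).exists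
  obtain ⟨ζ, zc, z0, z1, z2, -, hY⟩ := H R hRR
  filter_upwards [hY, self_mem_nhdsWithin] with t ht ht0
  have ht0 : 0 < t := ht0
  have h1 : ∫ x, YY μ U ζ m k t x ≤ wgt μ U x₁ * η := by
    refine (ht k).trans ?_
    rwa [show 2 * α - 1 = -(1 - 2 * α) by ring]
  have hcY := YY_cont hU μ zc m k t
  have hiY : Integrable (YY μ U ζ m k t) := int_cs hcY (r := 2 * R) fun x hx => by simp [YY, z2 x hx]
  have hY0 : ∀ x, 0 ≤ YY μ U ζ m k t x := fun x =>
    mul_nonneg (pow_nonneg (z0 x) _) (mul_nonneg (wgt_pos μ U x).le (div_nonneg (frob_self_nonneg _) (sq_nonneg _)))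
  have h2 : ∫ x in Metric.closedBall (0 : E3) r, YY μ U ζ m k t x ≤ ∫ x, YY μ U ζ m k t x :=
    setIntegral_le_integral hiY (Eventually.of_forall hY0)
  have hc : Continuous fun x => (eps U (x + t • ee k) i j - eps U x i j) ^ 2 :=
    (((eps_cont hU i j).comp (by fun_prop : Continuous fun x : E3 => x + t • ee k)).sub (eps_cont hU i j)).pow 2
  have h3 : ∫ x in Metric.closedBall (0 : E3) r, wgt μ U x₁ / t ^ 2 * (eps U (x + t • ee k) i j - eps U x i j) ^ 2
      ≤ ∫ x in Metric.closedBall (0 : E3) r, YY μ U ζ m k t x := by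
    refine setIntegral_mono_on ?_ hiY.integrableOn measurableSet_closedBall fun x hx => ?_
    · exact (hc.continuousOn.integrableOn_compact (isCompact_closedBall _ _)).const_mul _
    · have hxr : ‖x‖ ≤ r := by simpa using hx
      have l1 : wgt μ U x₁ ≤ wgt μ U x := hx₁ hx
      have l2 := entry_sq_le (eps U (x + t • ee k) - eps U x) i j
      unfold YY
      rw [z1 x (hxr.trans hRr), one_pow, one_mul, div_mul_eq_mul_div, ← mul_div_assoc]
      refine div_le_div_of_nonneg_right ?_ (sq_nonneg t)
      exact mul_le_mul l1 l2 (sq_nonneg _) (wgt_pos μ U x).le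
  rw [integral_const_mul] at h3
  have h4 := (h3.trans h2).trans h1
  rw [div_mul_eq_mul_div, div_le_iff₀ (by positivity), mul_assoc] at h4
  exact le_of_mul_le_mul_left h4 hw

/-- the symmetric gradient vanishes -/
lemma eps_zero {U : Fin 3 → E3 → ℝ} (hU : ∀ i, ContDiff ℝ 1 (U i)) {μ A α : ℝ} (hA : 0 < A) (hα : α < 1 / 2)
    {m : ℕ} {R₀ : ℝ} (hR₀ : 1 ≤ R₀)
    (H : ∀ R, R₀ ≤ R → ∃ ζ : E3 → ℝ, Continuous ζ ∧
      (∀ x, 0 ≤ ζ x) ∧ (∀ x, ‖x‖ ≤ R → ζ x = 1) ∧ (∀ x, 2 * R ≤ ‖x‖ → ζ x = 0) ∧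
      (∫ x, ζ x ^ (m + 2) * gsq U x) ≤ A * R ^ (1 + 2 * α) ∧
      ∀ᶠ t in nhdsWithin (0 : ℝ) (Set.Ioi 0), ∀ k, ∫ x, YY μ U ζ m k t x ≤ A * R ^ (2 * α - 1)) (x : E3) :
    eps U x = 0 := by
  have hcst := eps_const hU hA hα hR₀ H
  have hcst' : ∀ x, eps U x = eps U 0 := fun x => by ext i j; exact hcst x i j
  set c := frob (eps U 0) (eps U 0) with hc
  have hc0 : 0 ≤ c := frob_self_nonneg _
  set V := (volume : Measure E3).real (Metric.closedBall (0 : E3) 1) with hV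
  have hV0 : 0 < V := by
    rw [hV, Measure.real, ENNReal.toReal_pos_iff]
    exact ⟨Metric.measure_closedBall_pos _ _ one_pos, measure_closedBall_lt_top⟩
  have key : ∀ R, R₀ ≤ R → c * V ≤ A * R ^ (-(2 - 2 * α)) := by
    intro R hR
    have hR0 : 0 < R := by linarith
    obtain ⟨ζ, zc, z0, z1, z2, hX, -⟩ := H R hR
    have hi : Integrable fun x => ζ x ^ (m + 2) * gsq U x :=
      int_cs ((zc.pow _).mul (gsq_cont hU)) (r := 2 * R) fun x hx => by simp [z2 x hx]
    have h1 : ∫ x in Metric.closedBall (0 : E3) R, ζ x ^ (m + 2) * gsq U x ≤ ∫ x, ζ x ^ (m + 2) * gsq U x :=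
      setIntegral_le_integral hi (Eventually.of_forall fun x => mul_nonneg (pow_nonneg (z0 x) _) (gsq_nonneg U x))
    have h2 : ∫ x in Metric.closedBall (0 : E3) R, c ≤ ∫ x in Metric.closedBall (0 : E3) R, ζ x ^ (m + 2) * gsq U x := by
      refine setIntegral_mono_on ?_ hi.integrableOn measurableSet_closedBall fun x hx => ?_
      · exact continuous_const.continuousOn.integrableOn_compact (isCompact_closedBall _ _)
      · rw [z1 x (by simpa using hx), one_pow, one_mul, hc, ← hcst' x]
        exact eps_sq_le U x
    have h3 : (volume : Measure E3).real (Metric.closedBall (0 : E3) R) = R ^ 3 * V := by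
      rw [hV, Measure.real, Measure.addHaar_closedBall' _ _ hR0.le, ENNReal.toReal_mul,
        ENNReal.toReal_ofReal (by positivity)]
      simp [Measure.real]
    rw [setIntegral_const, h3, smul_eq_mul] at h2
    have h4 := (h2.trans h1).trans hX
    have e : R ^ (1 + 2 * α) = R ^ (-(2 - 2 * α)) * R ^ 3 := by
      rw [← Real.rpow_natCast R 3, ← Real.rpow_add hR0]; congr 1; push_cast; ring
    rw [e] at h4
    have : 0 < R ^ 3 := by positivity
    refine le_of_mul_le_mul_right (?_ : _ * R ^ 3 ≤ _ * R ^ 3) this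
    linarith
  have hlim : Tendsto (fun R : ℝ => A * R ^ (-(2 - 2 * α))) atTop (nhds 0) := by
    simpa using (tendsto_rpow_neg_atTop (show 0 < 2 - 2 * α by linarith)).const_mul A
  have h5 : c * V ≤ 0 := ge_of_tendsto hlim (eventually_atTop.2 ⟨R₀, key⟩)
  have h6 : c = 0 := by nlinarith
  rw [hcst' x]
  apply fnorm_eq_zero
  unfold fnorm
  rw [← hc, h6, Real.sqrt_zero]

/-- a field with vanishing symmetric gradient and sublinear growth is constant -/
lemma rigid {u : E3 → E3} (hu : ContDiff ℝ 1 u) (he : ∀ x, eps (fun i y => u y i) x = 0) {C₀ α : ℝ}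
    (hα₀ : 0 ≤ α) (hα : α < 1) (hC₀ : 0 < C₀) (hgr : ∀ x, ‖u x‖ ≤ C₀ * (1 + ‖x‖) ^ α) (a b : E3) : u a = u b := by
  have hq : ∀ x v : E3, inner ℝ (fderiv ℝ u x v) v = 0 := by
    intro x v
    have ev : v = ∑ j, v j • ee j := by
      ext i; simp [ee, Fin.sum_univ_three]; fin_cases i <;> simp
    have e1 : ∀ i, (fderiv ℝ u x v) i = ∑ j, v j * dd j (fun y => u y i) x := by
      intro i
      conv_lhs => rw [ev]
      simp only [map_sum, map_smul]
      simp only [← pd_eq hu, pd, ee]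
      simp [Fin.sum_univ_three]
    have e2 : ∀ i j, dd j (fun y => u y i) x + dd i (fun y => u y j) x = 0 := by
      intro i j
      have := congrFun (congrFun (he x) i) j
      simp only [eps, Matrix.zero_apply] at this
      linarith
    rw [PiLp.inner_apply]
    simp only [e1, RCLike.inner_apply, conj_trivial, Fin.sum_univ_three]
    linear_combination (v 0 ^ 2 / 2) * e2 0 0 + (v 1 ^ 2 / 2) * e2 1 1 + (v 2 ^ 2 / 2) * e2 2 2
      + v 0 * v 1 * e2 0 1 + v 0 * v 2 * e2 0 2 + v 1 * v 2 * e2 1 2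
  have hin : ∀ x y : E3, inner ℝ (u x - u y) (x - y) = 0 := by
    intro x y
    let g : ℝ → ℝ := fun s => inner ℝ (u (y + s • (x - y))) (x - y)
    have hg : ∀ s, HasDerivAt g 0 s := by
      intro s
      have h1 : HasDerivAt (fun s : ℝ => y + s • (x - y)) (x - y) s := by
        simpa using ((hasDerivAt_id s).smul_const (x - y)).const_add y
      have h2 := ((hu.differentiable (by norm_num) (y + s • (x - y))).hasFDerivAt).comp_hasDerivAt s h1
      have h3 := h2.inner ℝ (hasDerivAt_const s (x - y))
      rw [hq, inner_zero_right, zero_add] at h3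
      exact h3
    have := is_const_of_deriv_eq_zero (fun s => (hg s).differentiableAt) (fun s => (hg s).deriv) 1 0
    simp only [g, one_smul, zero_smul, add_zero, add_sub_cancel] at this
    rw [inner_sub_left, this, sub_self]
  set w := u b - u a with hw
  by_contra hne
  have hw0 : 0 < ‖w‖ := norm_pos_iff.2 (sub_ne_zero.2 (Ne.symm hne))
  set B := |inner ℝ (u b) b - inner ℝ (u a) a| with hB
  have key : ∀ s : ℝ, 1 ≤ s → ‖w‖ ^ 2 * s ≤ C₀ * (1 + ‖w‖) ^ α * s ^ α * ‖a - b‖ + B := by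
    intro s hs
    have h1 := hin (s • w) a
    have h2 := hin (s • w) b
    have e : s * ‖w‖ ^ 2 = inner ℝ (u (s • w)) (a - b) + (inner ℝ (u b) b - inner ℝ (u a) a) := by
      have e0 : s * ‖w‖ ^ 2 = inner ℝ w (s • w) := by
        rw [inner_smul_right, real_inner_self_eq_norm_sq]
      rw [e0]
      rw [hw] at h1 h2 ⊢
      simp only [inner_sub_left, inner_sub_right] at h1 h2 ⊢
      linarith
    have h3 := (le_abs_self _).trans (abs_real_inner_le_norm (u (s • w)) (a - b))
    have h4 := le_abs_self (inner ℝ (u b) b - inner ℝ (u a) a)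
    have h5 : ‖u (s • w)‖ ≤ C₀ * (1 + ‖w‖) ^ α * s ^ α := by
      refine (hgr _).trans ?_
      rw [mul_assoc, ← Real.mul_rpow (by positivity) (by linarith)]
      refine mul_le_mul_of_nonneg_left (Real.rpow_le_rpow (by positivity) ?_ hα₀) hC₀.le
      rw [norm_smul, Real.norm_of_nonneg (by linarith)]
      nlinarith
    have h6 := mul_le_mul_of_nonneg_right h5 (norm_nonneg (a - b))
    linarith
  have hlim : Tendsto (fun s : ℝ => C₀ * (1 + ‖w‖) ^ α * ‖a - b‖ * s ^ (-(1 - α)) + B * s⁻¹) atTop (nhds 0) := by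
    simpa using ((tendsto_rpow_neg_atTop (show 0 < 1 - α by linarith)).const_mul (C₀ * (1 + ‖w‖) ^ α * ‖a - b‖)).add
      (tendsto_inv_atTop_zero.const_mul B)
  have : ‖w‖ ^ 2 ≤ 0 := by
    refine ge_of_tendsto hlim (eventually_atTop.2 ⟨1, fun s hs => ?_⟩)
    have hs0 : 0 < s := by linarith
    have e : s ^ α = s ^ (-(1 - α)) * s := by
      conv_rhs => rw [← Real.rpow_one s, ← Real.rpow_mul hs0.le, ← Real.rpow_add hs0]
      congr 1; ring
    have k := key s hs
    rw [e] at k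
    refine le_of_mul_le_mul_right (k.trans (le_of_eq ?_)) hs0
    field_simp
  nlinarith

end

/-- Remark 5 of the paper: Liouville theorem for the 3D Stokes-type
system with μ-elliptic potential, 1 < μ < 2, under the growth condition
|x|^{-α}|u(x)| bounded for some α ∈ [0, 1/2). -/

theorem liouville_stokes_3d
    (h : ℝ → ℝ) (c₁ c₂ μ : ℝ)
    (hc₁ : 0 < c₁) (hc₂ : 0 < c₂) (hμ₁ : 1 < μ) (hμ₂ : μ < 2)
    (hreg : ContDiff ℝ 2 h)
    (hnonneg : ∀ t, 0 ≤ t → 0 ≤ h t)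
    (h0 : h 0 = 0) (h0' : deriv h 0 = 0)
    (hlow : ∀ t, 0 ≤ t →
      c₁ * (1 + t) ^ (-μ) ≤ min (deriv (deriv h) t) (slopeH h t))
    (hup : ∀ t, 0 ≤ t →
      max (deriv (deriv h) t) (slopeH h t) ≤ c₂ / (1 + t))
    (u : EuclideanSpace ℝ (Fin 3) → EuclideanSpace ℝ (Fin 3))
    (hu : ContDiff ℝ 1 u)
    (hdiv : ∀ x, divg u x = 0)
    (hweak : IsStokesWeakSolution h u)
    (α : ℝ) (hα₀ : 0 ≤ α) (hα : α < 1/2)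
    (hgrow : ∃ C : ℝ, ∀ x, x ≠ 0 → ‖x‖ ^ (-α) * ‖u x‖ ≤ C) :
    ∃ c, ∀ x, u x = c := by
  obtain ⟨C, hC⟩ := hgrow
  obtain ⟨C₀, hC₀d⟩ : ∃ C₀ : ℝ, C₀ = max C ‖u 0‖ + 1 := ⟨_, rfl⟩
  have hC₀ : 0 < C₀ := by
    have := (norm_nonneg (u 0)).trans (le_max_right C ‖u 0‖)
    linarith
  have hgr : ∀ x, ‖u x‖ ≤ C₀ * (1 + ‖x‖) ^ α := by
    intro x
    by_cases hx : x = 0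
    · subst hx
      have := le_max_right C ‖u 0‖
      simp only [norm_zero, add_zero, Real.one_rpow, mul_one]
      linarith
    · have hx0 : 0 < ‖x‖ := norm_pos_iff.2 hx
      have h1 := hC x hx
      have h2 : 0 < ‖x‖ ^ α := Real.rpow_pos_of_pos hx0 _
      rw [Real.rpow_neg hx0.le, inv_mul_le_iff₀ h2] at h1
      have h3 : ‖x‖ ^ α ≤ (1 + ‖x‖) ^ α := Real.rpow_le_rpow hx0.le (by linarith) hα₀
      have h4 : C ≤ C₀ := by
        have := le_max_left C ‖u 0‖
        linarith
      calc ‖u x‖ ≤ ‖x‖ ^ α * C := h1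
        _ ≤ ‖x‖ ^ α * C₀ := mul_le_mul_of_nonneg_left h4 h2.le
        _ ≤ (1 + ‖x‖) ^ α * C₀ := mul_le_mul_of_nonneg_right h3 hC₀.le
        _ = _ := mul_comm _ _
  let U : Fin 3 → E3 → ℝ := fun i y => u y i
  have hU : ∀ i, ContDiff ℝ 1 (U i) := fun i => comp_contDiff hu i
  have hsg : ∀ x, symGrad u x = eps U x := by
    intro x
    ext i j
    simp only [symGrad, eps, U, pd_eq hu]
  have hdivU : ∀ x, ∑ i, dd i (U i) x = 0 := by
    intro x
    rw [← hdiv x]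
    simp only [divg, U, pd_eq hu]
  let S : E3 → Matrix (Fin 3) (Fin 3) ℝ := fun x => DH h (eps U x)
  have hS : ∀ i j, Continuous fun x => S x i j := by
    intro i j
    rw [continuous_iff_continuousAt]
    intro x₀
    rw [ContinuousAt, tendsto_iff_norm_sub_tendsto_zero]
    have hcn : Continuous fun x => c₂ * fnorm (eps U x - eps U x₀) :=
      continuous_const.mul (cont_fnorm fun i j => (eps_cont hU i j).sub continuous_const)
    have h2 : Tendsto (fun x => c₂ * fnorm (eps U x - eps U x₀)) (nhds x₀) (nhds 0) := by
      have := hcn.tendsto x₀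
      simpa [fnorm, frob] using this
    refine squeeze_zero (fun x => norm_nonneg _) (fun x => ?_) h2
    exact DH_lip hc₁ hc₂ hμ₁ hreg h0' hlow hup (eps U x) (eps U x₀) i j
  have hsym : ∀ x i j, S x i j = S x j i := by
    intro x i j
    simp only [S, DH_eq, Matrix.smul_apply, eps]
    rw [add_comm]
  have hW : WeakC1 S := by
    rintro φ hφ ⟨r, hr⟩ hd
    refine weakC1 hS hsym (fun ψ p1 p2 p3 => ?_) hφ hr hd
    have := hweak ψ p1 p2 p3
    simpa only [hsg] using this
  have hUM : ∀ i x, |U i x| ≤ C₀ * (1 + ‖x‖) ^ α := fun i x =>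
    (PiLp.norm_apply_le (u x) i).trans (hgr x)
  obtain ⟨A, hA, m, R₀, hR₀, H⟩ := pack hU hdivU hS hsym hW hc₁ hc₂ hμ₁ hμ₂
    (fun x y => (DH_mono hc₁ hc₂ hμ₁ hreg h0' hlow hup (eps U x) (eps U y)).1)
    (fun x y => (DH_mono hc₁ hc₂ hμ₁ hreg h0' hlow hup (eps U x) (eps U y)).2) hC₀ hα₀ hα hUM
  have he := eps_zero hU hA hα hR₀ H
  exact ⟨u 0, fun x => rigid hu he hα₀ (by linarith) hC₀ hgr x 0⟩
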